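/- Let n ≥ 2. There exists a constant R > 1, depending only on n, with the following property: for every real polynomial f on ℝ^n with f ≥ 0 of degree m ≥ 2 and every ε > 0, there exists a global solution u to the thin obstacle problem (with zero obstacle) in ℝ^{n+1}, with polynomial growth of order exactly m, whose contact set satisfies ({x' : f(x') = 0} × {0}) ∩ B₁ ⊆ Λ(u) ⊆ {(x', 0) ∈ ℝ^{n+1} : dist(x', {f = 0}) ≤ ε} ∩ B_R, where B₁ and B_R are the balls of radii 1 and R in ℝ^{n+1} centered at the origin. -/

import Mathlib

open MeasureTheory Metric Set Filter

noncomputable section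

/-- The point `(x', t)` of `ℝ^{n+1}`, where `x' ∈ ℝ^n`. -/
def thinEmbed (n : ℕ) (x' : EuclideanSpace ℝ (Fin n)) (t : ℝ) :
    EuclideanSpace ℝ (Fin (n + 1)) :=
  (EuclideanSpace.equiv (Fin (n + 1)) ℝ).symm (Fin.snoc (fun i => x' i) t)

/-- Projection of a point of `ℝ^{n+1}` to its first `n` coordinates. -/
def thinProj (n : ℕ) (x : EuclideanSpace ℝ (Fin (n + 1))) : EuclideanSpace ℝ (Fin n) :=
  (EuclideanSpace.equiv (Fin n) ℝ).symm (fun i => x i.castSucc)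

/-- The Laplacian of `f : ℝ^d → ℝ`: the sum of pure second partial derivatives. -/
def lapl (d : ℕ) (f : EuclideanSpace ℝ (Fin d) → ℝ) (x : EuclideanSpace ℝ (Fin d)) : ℝ :=
  ∑ i : Fin d,
    fderiv ℝ (fun y => fderiv ℝ f y (EuclideanSpace.single i 1)) x (EuclideanSpace.single i 1)

/-- `f` is harmonic on a set: twice continuously differentiable with vanishing Laplacian. -/
def IsHarmonicOnSet (d : ℕ) (f : EuclideanSpace ℝ (Fin d) → ℝ)
    (s : Set (EuclideanSpace ℝ (Fin d))) : Prop :=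
  ContDiffOn ℝ 2 f s ∧ ∀ x ∈ s, lapl d f x = 0

/-- Super-mean-value property w.r.t. averages over balls
(encodes `Δf ≤ 0` for continuous `f`). -/
def SuperMeanVal (d : ℕ) (f : EuclideanSpace ℝ (Fin d) → ℝ) : Prop :=
  ∀ (x : EuclideanSpace ℝ (Fin d)) (r : ℝ), 0 < r → (⨍ y in Metric.ball x r, f y) ≤ f x

/-- The contact set `Λ_φ(u) = {(x',0) : u(x',0) = φ(x')}`. -/
def contactSet (n : ℕ) (φ : EuclideanSpace ℝ (Fin n) → ℝ)
    (u : EuclideanSpace ℝ (Fin (n + 1)) → ℝ) : Set (EuclideanSpace ℝ (Fin (n + 1))) :=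
  {x | x (Fin.last n) = 0 ∧ u x = φ (thinProj n x)}

/-- Global solution to the thin obstacle problem in `ℝ^{n+1}` with thin obstacle `φ`:
continuous, even in the last variable, above the obstacle on the thin space,
harmonic outside the contact set, and superharmonic (mean value inequality). -/
def IsGlobalSolution (n : ℕ) (φ : EuclideanSpace ℝ (Fin n) → ℝ)
    (u : EuclideanSpace ℝ (Fin (n + 1)) → ℝ) : Prop :=
  Continuous u ∧
  (∀ x' t, u (thinEmbed n x' t) = u (thinEmbed n x' (-t))) ∧
  (∀ x', φ x' ≤ u (thinEmbed n x' 0)) ∧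
  IsHarmonicOnSet (n + 1) u (contactSet n φ u)ᶜ ∧
  SuperMeanVal (n + 1) u

/-- Evaluation of a real polynomial at a point of `ℝ^d`. -/
def pev {d : ℕ} (q : MvPolynomial (Fin d) ℝ) (x : EuclideanSpace ℝ (Fin d)) : ℝ :=
  MvPolynomial.eval (fun i => x i) q

/-- Polynomial growth (of some order). -/
def HasPolyGrowth (d : ℕ) (u : EuclideanSpace ℝ (Fin d) → ℝ) : Prop :=
  ∃ (m : ℕ) (C : ℝ), ∀ x, |u x| ≤ C * (1 + ‖x‖ ^ m)

/-- Polynomial growth of order exactly `m` (and `m` is the smallest such order). -/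
def PolyGrowthOrder (d : ℕ) (u : EuclideanSpace ℝ (Fin d) → ℝ) (m : ℕ) : Prop :=
  (∃ C : ℝ, ∀ x, |u x| ≤ C * (1 + ‖x‖ ^ m)) ∧
  ∀ m' : ℕ, (∃ C : ℝ, ∀ x, |u x| ≤ C * (1 + ‖x‖ ^ m')) → m ≤ m'

/-- The class `𝒫ᵒ_{n+1}`: polynomials `q` even in the last variable such that
`x_{n+1} q(x)` is harmonic and `closure {q(·,0) < 0}` is compact. -/
def MemPo (n : ℕ) (q : MvPolynomial (Fin (n + 1)) ℝ) : Prop :=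
  (∀ x' t, pev q (thinEmbed n x' t) = pev q (thinEmbed n x' (-t))) ∧
  IsHarmonicOnSet (n + 1) (fun x => x (Fin.last n) * pev q x) Set.univ ∧
  IsCompact (closure {x' : EuclideanSpace ℝ (Fin n) | pev q (thinEmbed n x' 0) < 0})

/-- The class `𝒫ᵉ_{n+1}`: harmonic polynomials `p` even in the last variable such that
`closure {p(·,0) < 0}` is compact. -/
def MemPe (n : ℕ) (p : MvPolynomial (Fin (n + 1)) ℝ) : Prop :=
  (∀ x' t, pev p (thinEmbed n x' t) = pev p (thinEmbed n x' (-t))) ∧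
  IsHarmonicOnSet (n + 1) (pev p) Set.univ ∧
  IsCompact (closure {x' : EuclideanSpace ℝ (Fin n) | pev p (thinEmbed n x' 0) < 0})

/-- `f(x) → 0` as `|x| → ∞`. -/
def VanishAtInfty (d : ℕ) (f : EuclideanSpace ℝ (Fin d) → ℝ) : Prop :=
  ∀ ε > 0, ∃ R : ℝ, ∀ x, R ≤ ‖x‖ → |f x| < ε

/-- The embedding of a subset of `ℝ^n` into the thin space of `ℝ^{n+1}`. -/
def thinSet (n : ℕ) (S : Set (EuclideanSpace ℝ (Fin n))) :
    Set (EuclideanSpace ℝ (Fin (n + 1))) :=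
  (fun x' => thinEmbed n x' 0) '' S

/-- The free boundary `Γ(u)`: the boundary in `ℝ^n` of the positivity set, embedded. -/
def freeBoundary (n : ℕ) (u : EuclideanSpace ℝ (Fin (n + 1)) → ℝ) :
    Set (EuclideanSpace ℝ (Fin (n + 1))) :=
  thinSet n (frontier {x' : EuclideanSpace ℝ (Fin n) | 0 < u (thinEmbed n x' 0)})

/-- Negating the `i`-th coordinate of a point of `ℝ^d`. -/
def negCoordAt (d : ℕ) (i : Fin d) (x : EuclideanSpace ℝ (Fin d)) :
    EuclideanSpace ℝ (Fin d) :=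
  (EuclideanSpace.equiv (Fin d) ℝ).symm (Function.update (fun j => x j) i (-(x i)))

/-- The constant `ρ̄(k, n)`, where `κ = k/(n-1)`. -/
def rhoBar (k n : ℕ) : ℝ :=
  ((k : ℝ) / ((n : ℝ) - 1)) ^ (-(1 : ℝ) / (((n : ℝ) - 1) * ((k : ℝ) / ((n : ℝ) - 1) + 1))) *
    (((k : ℝ) / ((n : ℝ) - 1)) ^
        (-((k : ℝ) / ((n : ℝ) - 1)) / ((k : ℝ) / ((n : ℝ) - 1) + 1)) +
      ((k : ℝ) / ((n : ℝ) - 1)) ^ ((1 : ℝ) / ((k : ℝ) / ((n : ℝ) - 1) + 1))) ^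
      (-(1 : ℝ) / (((n : ℝ) - 1) * ((k : ℝ) / ((n : ℝ) - 1))))

/-- The barrier function `g_{A,t}(r) = A r^{1-n} + t - 1 + r^k`. -/
def gfun (n k : ℕ) (A t r : ℝ) : ℝ :=
  A * r ^ ((1 : ℝ) - (n : ℝ)) + t - 1 + r ^ k

section LaplacianBasics

variable {d : ℕ} {f g : EuclideanSpace ℝ (Fin d) → ℝ} {x : EuclideanSpace ℝ (Fin d)}

lemma lapl_eq_sum_fderiv_fderiv (hf : ContDiffAt ℝ 2 f x) :
    lapl d f x = ∑ i : Fin d, fderiv ℝ (fderiv ℝ f) x (EuclideanSpace.single i 1)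
      (EuclideanSpace.single i 1) := by
  have h1 : ContDiffAt ℝ 1 (fderiv ℝ f) x := hf.fderiv_right (by norm_num)
  have h2 : DifferentiableAt ℝ (fderiv ℝ f) x := h1.differentiableAt (by norm_num)
  refine Finset.sum_congr rfl fun i _ => ?_
  have := h2.hasFDerivAt.clm_apply
    (hasFDerivAt_const (EuclideanSpace.single i (1 : ℝ) : EuclideanSpace ℝ (Fin d)) x)
  rw [this.fderiv]
  simp

lemma lapl_congr_nhds (h : f =ᶠ[nhds x] g) : lapl d f x = lapl d g x := by
  refine Finset.sum_congr rfl fun i _ => ?_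
  have h1 : (fun y => fderiv ℝ f y (EuclideanSpace.single i 1)) =ᶠ[nhds x]
      fun y => fderiv ℝ g y (EuclideanSpace.single i 1) :=
    (h.fderiv (𝕜 := ℝ)).mono fun y hy => by simp only [hy]
  rw [h1.fderiv_eq]

lemma lapl_add (hf : ContDiffAt ℝ 2 f x) (hg : ContDiffAt ℝ 2 g x) :
    lapl d (fun y => f y + g y) x = lapl d f x + lapl d g x := by
  rw [lapl_eq_sum_fderiv_fderiv hf, lapl_eq_sum_fderiv_fderiv hg,
    lapl_eq_sum_fderiv_fderiv (hf.add hg), ← Finset.sum_add_distrib]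
  have h1 : fderiv ℝ (fun y => f y + g y) =ᶠ[nhds x] fun y => fderiv ℝ f y + fderiv ℝ g y := by
    filter_upwards [hf.eventually (by simp), hg.eventually (by simp)] with y hy hy'
    exact fderiv_fun_add (hy.differentiableAt (by norm_num)) (hy'.differentiableAt (by norm_num))
  have hf1 : DifferentiableAt ℝ (fderiv ℝ f) x :=
    ContDiffAt.differentiableAt (n := 1) (hf.fderiv_right (by norm_num)) (by norm_num)
  have hg1 : DifferentiableAt ℝ (fderiv ℝ g) x :=
    ContDiffAt.differentiableAt (n := 1) (hg.fderiv_right (by norm_num)) (by norm_num)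
  rw [h1.fderiv_eq, fderiv_fun_add hf1 hg1]
  rfl

lemma lapl_const_mul (c : ℝ) (hf : ContDiffAt ℝ 2 f x) :
    lapl d (fun y => c * f y) x = c * lapl d f x := by
  rw [lapl_eq_sum_fderiv_fderiv hf, lapl_eq_sum_fderiv_fderiv (contDiffAt_const.mul hf),
    Finset.mul_sum]
  have h1 : fderiv ℝ (fun y => c * f y) =ᶠ[nhds x] fun y => c • fderiv ℝ f y := by
    filter_upwards [hf.eventually (by simp)] with y hy
    exact fderiv_const_mul (hy.differentiableAt (by norm_num)) c
  have hf1 : DifferentiableAt ℝ (fderiv ℝ f) x :=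
    ContDiffAt.differentiableAt (n := 1) (hf.fderiv_right (by norm_num)) (by norm_num)
  rw [h1.fderiv_eq, fderiv_fun_const_smul hf1]
  rfl

lemma lapl_neg (hf : ContDiffAt ℝ 2 f x) : lapl d (fun y => -f y) x = -lapl d f x := by
  simpa using lapl_const_mul (-1) hf

lemma lapl_sub (hf : ContDiffAt ℝ 2 f x) (hg : ContDiffAt ℝ 2 g x) :
    lapl d (fun y => f y - g y) x = lapl d f x - lapl d g x := by
  simp only [sub_eq_add_neg]
  rw [lapl_add hf hg.neg, lapl_neg hg]

lemma lapl_const (c : ℝ) : lapl d (fun _ => c) x = 0 := by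
  simp [lapl]

lemma lapl_comp_add_right (a : EuclideanSpace ℝ (Fin d)) :
    lapl d (fun y => f (y + a)) x = lapl d f (x + a) := by
  unfold lapl
  refine Finset.sum_congr rfl fun i _ => ?_
  simp_rw [fderiv_comp_add_right]
  rw [fderiv_comp_add_right a (f := fun y => fderiv ℝ f y (EuclideanSpace.single i 1))]

end LaplacianBasics

section PolynomialFunctions

variable {d : ℕ}

lemma pev_add (p q : MvPolynomial (Fin d) ℝ) (x : EuclideanSpace ℝ (Fin d)) :
    pev (p + q) x = pev p x + pev q x := by simp [pev]

lemma pev_sub (p q : MvPolynomial (Fin d) ℝ) (x : EuclideanSpace ℝ (Fin d)) :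
    pev (p - q) x = pev p x - pev q x := by simp [pev]

lemma pev_mul (p q : MvPolynomial (Fin d) ℝ) (x : EuclideanSpace ℝ (Fin d)) :
    pev (p * q) x = pev p x * pev q x := by simp [pev]

lemma pev_C (c : ℝ) (x : EuclideanSpace ℝ (Fin d)) : pev (MvPolynomial.C c) x = c := by
  simp [pev]

lemma pev_X (i : Fin d) (x : EuclideanSpace ℝ (Fin d)) : pev (MvPolynomial.X i) x = x i := by
  simp [pev]

lemma contDiff_pev {k : WithTop ℕ∞} (p : MvPolynomial (Fin d) ℝ) : ContDiff ℝ k (pev p) := by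
  induction p using MvPolynomial.induction_on with
  | C a => simpa only [funext (pev_C a)] using contDiff_const
  | add p q hp hq => simpa only [funext (pev_add p q)] using hp.add hq
  | mul_X p i hp =>
    simp only [funext (pev_mul p _), pev_X]
    exact hp.mul (by fun_prop)

lemma continuous_pev (p : MvPolynomial (Fin d) ℝ) : Continuous (pev p) :=
  (contDiff_pev (k := 0) p).continuous

lemma fderiv_pev (p : MvPolynomial (Fin d) ℝ) (x : EuclideanSpace ℝ (Fin d)) (i : Fin d) :
    fderiv ℝ (pev p) x (EuclideanSpace.single i 1) = pev (MvPolynomial.pderiv i p) x := by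
  induction p using MvPolynomial.induction_on with
  | C a => simp [funext (pev_C (d := d) a), pev]
  | add p q hp hq =>
    rw [funext (pev_add p q), fderiv_fun_add, map_add, pev_add, ← hp, ← hq]
    · rfl
    · exact (contDiff_pev (k := 1) p).differentiable (by norm_num) x
    · exact (contDiff_pev (k := 1) q).differentiable (by norm_num) x
  | mul_X p j hp =>
    have h1 : HasFDerivAt (pev (MvPolynomial.X j : MvPolynomial (Fin d) ℝ))
        (EuclideanSpace.proj j : EuclideanSpace ℝ (Fin d) →L[ℝ] ℝ) x := by
      rw [funext (pev_X j)]
      exact (EuclideanSpace.proj j : EuclideanSpace ℝ (Fin d) →L[ℝ] ℝ).hasFDerivAt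
    have h2 := ((contDiff_pev (k := 1) p).differentiable (by norm_num) x).hasFDerivAt.mul h1
    have h3 : fderiv ℝ (pev (p * MvPolynomial.X j)) x = _ :=
      (h2.congr_of_eventuallyEq (Eventually.of_forall fun y => pev_mul p _ y)).fderiv
    rw [h3, Derivation.leibniz, MvPolynomial.pderiv_X]
    simp [pev_add, pev_mul, hp, pev_X]
    by_cases hij : i = j
    · subst hij; simp [pev]
    · simp [pev, Ne.symm hij]

/-- The Laplacian on polynomials. -/
def polyLapl (d : ℕ) : MvPolynomial (Fin d) ℝ →ₗ[ℝ] MvPolynomial (Fin d) ℝ :=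
  ∑ i : Fin d, (MvPolynomial.pderiv i).toLinearMap ∘ₗ (MvPolynomial.pderiv i).toLinearMap

lemma polyLapl_apply (p : MvPolynomial (Fin d) ℝ) :
    polyLapl d p = ∑ i : Fin d, MvPolynomial.pderiv i (MvPolynomial.pderiv i p) := by
  simp [polyLapl]

lemma lapl_pev (p : MvPolynomial (Fin d) ℝ) (x : EuclideanSpace ℝ (Fin d)) :
    lapl d (pev p) x = pev (polyLapl d p) x := by
  unfold lapl
  simp_rw [funext fun y => fderiv_pev p y _, fderiv_pev]
  simp [polyLapl_apply, pev]

/-- The polynomial `|x - c|²`. -/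
def sqDistPoly (c : EuclideanSpace ℝ (Fin d)) : MvPolynomial (Fin d) ℝ :=
  ∑ i, (MvPolynomial.X i - MvPolynomial.C (c i)) ^ 2

lemma pev_sqDistPoly (c x : EuclideanSpace ℝ (Fin d)) : pev (sqDistPoly c) x = ‖x - c‖ ^ 2 := by
  simp [sqDistPoly, pev, EuclideanSpace.norm_sq_eq]

lemma polyLapl_sqDistPoly (c : EuclideanSpace ℝ (Fin d)) :
    polyLapl d (sqDistPoly c) = MvPolynomial.C (2 * d : ℝ) := by
  rw [polyLapl_apply]
  have : ∀ i, MvPolynomial.pderiv i (MvPolynomial.pderiv i (sqDistPoly c)) =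
      MvPolynomial.C (2 : ℝ) := by
    intro i
    have h : MvPolynomial.pderiv i (sqDistPoly c) =
        2 * (MvPolynomial.X i - MvPolynomial.C (c i)) := by
      simp [sqDistPoly, MvPolynomial.pderiv_X, Derivation.leibniz_pow, Pi.single_apply]
    rw [h, show (2 : MvPolynomial (Fin d) ℝ) = MvPolynomial.C 2 from (map_ofNat _ 2).symm]
    simp [Derivation.leibniz]
  simp [this, mul_comm]

lemma lapl_sq_dist (c x : EuclideanSpace ℝ (Fin d)) :
    lapl d (fun y => ‖y - c‖ ^ 2) x = 2 * d := by
  rw [← funext (pev_sqDistPoly c), lapl_pev, polyLapl_sqDistPoly, pev_C]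

lemma contDiff_sq_dist {k : WithTop ℕ∞} (c : EuclideanSpace ℝ (Fin d)) :
    ContDiff ℝ k (fun y => ‖y - c‖ ^ 2) := by
  rw [← funext (pev_sqDistPoly c)]
  exact contDiff_pev _

end PolynomialFunctions

section MaximumPrinciple

variable {d : ℕ} {f : EuclideanSpace ℝ (Fin d) → ℝ}

lemma deriv_deriv_nonpos_of_isLocalMax {φ : ℝ → ℝ} (hφ : ContDiffAt ℝ 2 φ 0)
    (hm : IsLocalMax φ 0) : deriv (deriv φ) 0 ≤ 0 := by
  by_contra! hpos
  have h1 := isLocalMin_of_deriv_deriv_pos hpos hm.deriv_eq_zero hφ.continuousAt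
  have h2 : φ =ᶠ[nhds 0] fun _ => φ 0 := by
    filter_upwards [hm, h1] with t h h'
    exact le_antisymm h h'
  have h3 : deriv (deriv φ) 0 = 0 := by
    have h4 : deriv φ =ᶠ[nhds 0] fun _ => 0 := by
      simpa using h2.deriv
    simpa using h4.deriv_eq
  linarith

lemma lapl_nonpos_of_isLocalMax {x : EuclideanSpace ℝ (Fin d)} (hf : ContDiffAt ℝ 2 f x)
    (hm : IsLocalMax f x) : lapl d f x ≤ 0 := by
  refine Finset.sum_nonpos fun i _ => ?_
  set e : EuclideanSpace ℝ (Fin d) := EuclideanSpace.single i 1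
  have hline : ∀ t : ℝ, HasDerivAt (fun t : ℝ => x + t • e) e t := fun t => by
    simpa using ((hasDerivAt_id t).smul_const e).const_add x
  have hc : ContDiff ℝ 2 fun t : ℝ => x + t • e := by fun_prop
  have hx0 : x + (0 : ℝ) • e = x := by simp
  have hφ : ContDiffAt ℝ 2 (fun t : ℝ => f (x + t • e)) 0 :=
    ContDiffAt.comp (0 : ℝ) (g := f) (by rw [hx0]; exact hf) hc.contDiffAt
  have hcont : Tendsto (fun t : ℝ => x + t • e) (nhds 0) (nhds x) := by
    have := hc.continuous.tendsto 0
    rwa [hx0] at this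
  have hmax : IsLocalMax (fun t : ℝ => f (x + t • e)) 0 := by
    have := hcont.eventually hm
    simpa [IsLocalMax, IsMaxFilter] using this
  have key := deriv_deriv_nonpos_of_isLocalMax hφ hmax
  have h1 : deriv (fun t : ℝ => f (x + t • e)) =ᶠ[nhds 0] fun t => fderiv ℝ f (x + t • e) e := by
    filter_upwards [hcont.eventually (hf.eventually (by simp))] with t ht
    exact ((ht.differentiableAt (by norm_num)).hasFDerivAt.comp_hasDerivAt t (hline t)).deriv
  rw [h1.deriv_eq] at key
  have hf1 : ContDiffAt ℝ 1 (fderiv ℝ f) x := hf.fderiv_right (by norm_num)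
  have hd : DifferentiableAt ℝ (fun y => fderiv ℝ f y e) (x + (0 : ℝ) • e) := by
    rw [hx0]
    exact (hf1.differentiableAt (by norm_num)).clm_apply (differentiableAt_const _)
  have h2 := (hd.hasFDerivAt.comp_hasDerivAt (0 : ℝ) (hline 0)).deriv
  rw [hx0] at h2
  rw [← h2]
  exact key

/-- The weak maximum principle for subharmonic functions on bounded open sets. -/
theorem le_zero_of_lapl_nonneg [NeZero d] {U : Set (EuclideanSpace ℝ (Fin d))} (hU : IsOpen U)
    (hb : Bornology.IsBounded U) (hc : ContinuousOn f (closure U))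
    (h2 : ∀ x ∈ U, ContDiffAt ℝ 2 f x) (hl : ∀ x ∈ U, 0 ≤ lapl d f x)
    (hfr : ∀ x ∈ frontier U, f x ≤ 0) : ∀ x ∈ closure U, f x ≤ 0 := by
  intro x hx
  have hd : 0 < d := NeZero.pos d
  obtain ⟨M, hM⟩ := hb.closure.exists_norm_le
  have hcpt : IsCompact (closure U) := hb.isCompact_closure
  by_contra! hpos
  set η : ℝ := f x / (2 * (M ^ 2 + 1))
  have hη : 0 < η := by positivity
  have hηM : η * M ^ 2 < f x := by
    have : η * (2 * (M ^ 2 + 1)) = f x := by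
      simp only [η]; field_simp
    nlinarith
  set g := fun y => f y + η * ‖y - 0‖ ^ 2
  have hgc : ContinuousOn g (closure U) :=
    hc.add (continuousOn_const.mul (contDiff_sq_dist (k := 0) 0).continuous.continuousOn)
  obtain ⟨z, hz, hzmax⟩ := hcpt.exists_isMaxOn ⟨x, hx⟩ hgc
  have hgx : f x ≤ g x := by simp only [g]; nlinarith [sq_nonneg ‖x - 0‖]
  have hgz : f x ≤ g z := hgx.trans (hzmax hx)
  by_cases hzU : z ∈ U
  · have hloc : IsLocalMax g z := by
      filter_upwards [hU.mem_nhds hzU] with y hy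
      exact hzmax (subset_closure hy)
    have hq : ContDiffAt ℝ 2 (fun y : EuclideanSpace ℝ (Fin d) => ‖y - 0‖ ^ 2) z :=
      (contDiff_sq_dist 0).contDiffAt
    have h3 := lapl_nonpos_of_isLocalMax (f := g) ((h2 z hzU).add (contDiffAt_const.mul hq)) hloc
    rw [lapl_add (h2 z hzU) (contDiffAt_const.mul hq), lapl_const_mul _ hq, lapl_sq_dist] at h3
    have h4 : (0 : ℝ) < η * (2 * d) := by positivity
    linarith [hl z hzU]
  · have h3 := hfr z (by rw [hU.frontier_eq]; exact ⟨hz, hzU⟩)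
    have h4 : ‖z‖ ^ 2 ≤ M ^ 2 := pow_le_pow_left₀ (norm_nonneg _) (hM z hz) 2
    simp only [g, sub_zero] at hgz
    nlinarith

end MaximumPrinciple

section PolynomialDirichlet

variable {d : ℕ}

lemma eq_zero_of_pev_eq_zero_on_open {p : MvPolynomial (Fin d) ℝ}
    {U : Set (EuclideanSpace ℝ (Fin d))} (hU : IsOpen U) {c : EuclideanSpace ℝ (Fin d)}
    (hc : c ∈ U) (h : ∀ x ∈ U, pev p x = 0) : p = 0 := by
  set e := EuclideanSpace.equiv (Fin d) ℝ
  have hV : IsOpen (e.symm ⁻¹' U) := hU.preimage e.symm.continuous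
  obtain ⟨ρ, hρ, hsub⟩ := Metric.isOpen_iff.1 hV (e c) (by simpa using hc)
  refine MvPolynomial.funext_set (fun i => ball (e c i) ρ) (fun i => ?_) fun x hx => ?_
  · rw [Real.ball_eq_Ioo]
    exact Ioo_infinite (by linarith)
  · have hx' : x ∈ ball (e c) ρ := by rwa [ball_pi _ hρ]
    rw [map_zero]
    exact h _ (hsub hx')

lemma totalDegree_pderiv_le (i : Fin d) (p : MvPolynomial (Fin d) ℝ) :
    (MvPolynomial.pderiv i p).totalDegree ≤ p.totalDegree - 1 := by
  conv_lhs => rw [p.as_sum, map_sum]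
  refine (MvPolynomial.totalDegree_finsetSum _ _).trans (Finset.sup_le fun m hm => ?_)
  rw [MvPolynomial.pderiv_monomial]
  by_cases hmi : m i = 0
  · simp [hmi]
  · refine (MvPolynomial.totalDegree_monomial_le _ _).trans ?_
    have h1 : (m.sum fun _ e => e) ≤ p.totalDegree := MvPolynomial.le_totalDegree hm
    have h2 : Finsupp.single i 1 ≤ m := by
      rw [Finsupp.single_le_iff]; omega
    have h3 : m = (m - Finsupp.single i 1) + Finsupp.single i 1 := (tsub_add_cancel_of_le h2).symm
    have h4 : (m.sum fun _ e => e) = ((m - Finsupp.single i 1).sum fun _ e => e) + 1 := by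
      conv_lhs => rw [h3]
      rw [Finsupp.sum_add_index' (by simp) (by simp)]
      simp
    simp only [Function.id_def] at *
    change ((m - Finsupp.single i 1).sum fun _ e => e) ≤ _
    omega

lemma totalDegree_polyLapl_le (p : MvPolynomial (Fin d) ℝ) :
    (polyLapl d p).totalDegree ≤ p.totalDegree - 2 := by
  rw [polyLapl_apply]
  refine (MvPolynomial.totalDegree_finsetSum _ _).trans (Finset.sup_le fun i _ => ?_)
  have h1 := totalDegree_pderiv_le i (MvPolynomial.pderiv i p)
  have h2 := totalDegree_pderiv_le i p
  omega

lemma totalDegree_sqDistPoly_le (c : EuclideanSpace ℝ (Fin d)) :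
    (sqDistPoly c).totalDegree ≤ 2 := by
  refine (MvPolynomial.totalDegree_finsetSum _ _).trans (Finset.sup_le fun i _ => ?_)
  refine (MvPolynomial.totalDegree_pow _ _).trans ?_
  have := MvPolynomial.totalDegree_sub_C_le (MvPolynomial.X i : MvPolynomial (Fin d) ℝ) (c i)
  rw [MvPolynomial.totalDegree_X] at this
  omega

/-- The Dirichlet problem on balls with polynomial data has polynomial solutions. -/
theorem exists_harmonic_polynomial_eq_on_sphere [NeZero d] (P : MvPolynomial (Fin d) ℝ)
    (c : EuclideanSpace ℝ (Fin d)) {r : ℝ} (hr : 0 < r) :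
    ∃ H : MvPolynomial (Fin d) ℝ, polyLapl d H = 0 ∧ ∀ x ∈ sphere c r, pev H x = pev P x := by
  set N : MvPolynomial (Fin d) ℝ := MvPolynomial.C (r ^ 2) - sqDistPoly c
  have hN : ∀ x, pev N x = r ^ 2 - ‖x - c‖ ^ 2 := fun x => by
    simp only [N, pev_sub, pev_C, pev_sqDistPoly]
  have hNdeg : N.totalDegree ≤ 2 := by
    refine (MvPolynomial.totalDegree_sub _ _).trans (max_le ?_ (totalDegree_sqDistPoly_le c))
    rw [MvPolynomial.totalDegree_C]; norm_num
  set V := MvPolynomial.restrictTotalDegree (Fin d) ℝ P.totalDegree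
  have hmem : ∀ q ∈ V, polyLapl d (N * q) ∈ V := by
    intro q hq
    rw [MvPolynomial.mem_restrictTotalDegree] at hq ⊢
    have h1 := totalDegree_polyLapl_le (N * q)
    have h2 := MvPolynomial.totalDegree_mul N q
    omega
  let T : V →ₗ[ℝ] V := (polyLapl d ∘ₗ LinearMap.mulLeft ℝ N).restrict hmem
  have hinj : Function.Injective T := by
    rw [← LinearMap.ker_eq_bot, LinearMap.ker_eq_bot']
    rintro ⟨q, hq⟩ hTq
    have h0 : polyLapl d (N * q) = 0 := congrArg Subtype.val hTq
    have hl : ∀ x, lapl d (pev (N * q)) x = 0 := fun x => by rw [lapl_pev, h0]; simp [pev]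
    have hsph : ∀ x ∈ frontier (ball c r), pev (N * q) x = 0 := by
      intro x hx
      rw [frontier_ball c hr.ne', mem_sphere, dist_eq_norm] at hx
      rw [pev_mul, hN, hx]; ring
    have h1 := le_zero_of_lapl_nonneg (f := pev (N * q)) isOpen_ball isBounded_ball
      (continuous_pev _).continuousOn (fun x _ => (contDiff_pev _).contDiffAt)
      (fun x _ => (hl x).ge) (fun x hx => (hsph x hx).le)
    have h2 := le_zero_of_lapl_nonneg (f := fun x => -pev (N * q) x) (isOpen_ball (x := c) (ε := r))
      isBounded_ball (continuous_pev _).neg.continuousOn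
      (fun x _ => (contDiff_pev _).contDiffAt.neg)
      (fun x _ => by rw [lapl_neg (contDiff_pev _).contDiffAt, hl x]; simp)
      (fun x hx => by simp [hsph x hx])
    have hq0 : q = 0 := by
      refine eq_zero_of_pev_eq_zero_on_open (U := ball c r) isOpen_ball (mem_ball_self hr) fun x hx => ?_
      have h3 : pev (N * q) x = 0 :=
        le_antisymm (h1 x (subset_closure hx)) (by linarith [h2 x (subset_closure hx)])
      rw [pev_mul, hN] at h3
      rw [mem_ball, dist_eq_norm] at hx
      have h4 : r ^ 2 - ‖x - c‖ ^ 2 ≠ 0 := by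
        have := pow_lt_pow_left₀ hx (norm_nonneg _) two_ne_zero
        linarith
      exact (mul_eq_zero.1 h3).resolve_left h4
    exact Subtype.ext hq0
  have hPV : polyLapl d P ∈ V := by
    rw [MvPolynomial.mem_restrictTotalDegree]
    have := totalDegree_polyLapl_le P
    omega
  obtain ⟨⟨q, hq⟩, hTq⟩ := LinearMap.injective_iff_surjective.1 hinj ⟨_, hPV⟩
  have h0 : polyLapl d (N * q) = polyLapl d P := congrArg Subtype.val hTq
  refine ⟨P - N * q, by rw [map_sub, h0, sub_self], fun x hx => ?_⟩
  rw [mem_sphere, dist_eq_norm] at hx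
  rw [pev_sub, pev_mul, hN, hx]; ring

end PolynomialDirichlet

section RadialMeanValue

variable {d : ℕ}

lemma fderiv_pev_apply (p : MvPolynomial (Fin d) ℝ) (x y : EuclideanSpace ℝ (Fin d)) :
    fderiv ℝ (pev p) x y = ∑ i, y i * pev (MvPolynomial.pderiv i p) x := by
  conv_lhs => rw [← (EuclideanSpace.basisFun (Fin d) ℝ).sum_repr y]
  simp [fderiv_pev]

lemma hasFDerivAt_pev_add_smul (p : MvPolynomial (Fin d) ℝ) (x y : EuclideanSpace ℝ (Fin d))
    (s : ℝ) :
    HasFDerivAt (fun y => pev p (x + s • y)) (s • fderiv ℝ (pev p) (x + s • y)) y := by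
  have h1 : HasFDerivAt (fun y : EuclideanSpace ℝ (Fin d) => x + s • y)
      (s • ContinuousLinearMap.id ℝ (EuclideanSpace ℝ (Fin d))) y :=
    ((hasFDerivAt_id y).const_smul s).const_add x
  have h2 := ((contDiff_pev (k := 1) p).differentiable (by norm_num) (x + s • y)).hasFDerivAt
  have h3 := h2.comp y h1
  convert! h3 using 1
  ext v
  simp

variable {κ : ℝ → ℝ} {ρ : ℝ}

lemma hasCompactSupport_radial_mul (hρ : 0 ≤ ρ) (hκ0 : ∀ s, ρ ^ 2 ≤ s → κ s = 0)
    (g : EuclideanSpace ℝ (Fin d) → ℝ) : HasCompactSupport fun y => κ (‖y‖ ^ 2) * g y := by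
  refine HasCompactSupport.intro (isCompact_closedBall 0 ρ) fun y hy => ?_
  rw [mem_closedBall, dist_zero_right, not_le] at hy
  rw [hκ0 _ (pow_le_pow_left₀ hρ hy.le 2), zero_mul]

lemma integrable_radial_mul (hκ : Continuous κ) (hρ : 0 ≤ ρ) (hκ0 : ∀ s, ρ ^ 2 ≤ s → κ s = 0)
    {g : EuclideanSpace ℝ (Fin d) → ℝ} (hg : Continuous g) :
    Integrable fun y => κ (‖y‖ ^ 2) * g y :=
  Continuous.integrable_of_hasCompactSupport (by fun_prop) (hasCompactSupport_radial_mul hρ hκ0 g)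

lemma integral_radial_mul_fderiv_eq_zero (hκ : Continuous κ) (hρ : 0 ≤ ρ)
    (hκ0 : ∀ s, ρ ^ 2 ≤ s → κ s = 0) {H : MvPolynomial (Fin d) ℝ} (hH : polyLapl d H = 0)
    (x : EuclideanSpace ℝ (Fin d)) (s : ℝ) :
    ∫ y, κ (‖y‖ ^ 2) * fderiv ℝ (pev H) (x + s • y) y = 0 := by
  set K : ℝ → ℝ := fun s => ∫ t in (ρ ^ 2)..s, κ t
  have hK : ∀ s, HasDerivAt K (κ s) s := fun s => hκ.integral_hasStrictDerivAt _ s |>.hasDerivAt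
  have hKc : Continuous K := continuous_iff_continuousAt.2 fun s => (hK s).continuousAt
  have hK0 : ∀ s, ρ ^ 2 ≤ s → K s = 0 := fun s hs => by
    have : EqOn κ 0 (uIcc (ρ ^ 2) s) := fun t ht => by
      rw [uIcc_of_le hs] at ht
      exact hκ0 t ht.1
    simp only [K]
    rw [intervalIntegral.integral_congr this]
    simp
  have hk : ∀ y : EuclideanSpace ℝ (Fin d), HasFDerivAt (fun y => K (‖y‖ ^ 2) * 1)
      (κ (‖y‖ ^ 2) • (2 • innerSL ℝ y)) y := fun y => by
    simp only [mul_one]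
    exact (hK _).comp_hasFDerivAt y (hasStrictFDerivAt_norm_sq y).hasFDerivAt
  have hparts : ∀ i : Fin d, ∫ y : EuclideanSpace ℝ (Fin d),
      κ (‖y‖ ^ 2) * (2 * y i * pev (MvPolynomial.pderiv i H) (x + s • y)) =
      -∫ y : EuclideanSpace ℝ (Fin d), K (‖y‖ ^ 2) *
        (s * pev (MvPolynomial.pderiv i (MvPolynomial.pderiv i H)) (x + s • y)) := by
    intro i
    set G := MvPolynomial.pderiv i H
    have hGc := continuous_pev G
    have hGc' := continuous_pev (MvPolynomial.pderiv i G)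
    have e1 : ∀ y : EuclideanSpace ℝ (Fin d), fderiv ℝ (fun y => K (‖y‖ ^ 2) * 1) y
        (EuclideanSpace.single i 1) = κ (‖y‖ ^ 2) * (2 * y i) := fun y => by
      rw [(hk y).fderiv]
      simp [EuclideanSpace.inner_single_right]
    have e2 : ∀ y : EuclideanSpace ℝ (Fin d), fderiv ℝ (fun y => pev G (x + s • y)) y
        (EuclideanSpace.single i 1) = s * pev (MvPolynomial.pderiv i G) (x + s • y) := fun y => by
      rw [(hasFDerivAt_pev_add_smul G x y s).fderiv]
      simp [fderiv_pev]
    have := integral_mul_fderiv_eq_neg_fderiv_mul_of_integrable (μ := volume)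
      (f := fun y : EuclideanSpace ℝ (Fin d) => K (‖y‖ ^ 2) * 1)
      (g := fun y => pev G (x + s • y)) (v := EuclideanSpace.single i 1)
      (by simp_rw [e1, mul_assoc]
          exact integrable_radial_mul hκ hρ hκ0 (by fun_prop))
      (by simp_rw [e2, mul_assoc]
          exact integrable_radial_mul hKc hρ hK0 (by fun_prop))
      (by simp_rw [mul_assoc]
          exact integrable_radial_mul hKc hρ hK0 (by fun_prop))
      (fun y _ => (hk y).differentiableAt)
      (fun y _ => (hasFDerivAt_pev_add_smul G x y s).differentiableAt)
    simp_rw [e1, e2] at this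
    rw [eq_comm, neg_eq_iff_eq_neg] at this
    simp only [mul_one] at this
    rw [← neg_eq_iff_eq_neg.2 this, neg_neg]
    refine integral_congr_ae (Eventually.of_forall fun y => ?_)
    simp only []
    ring
  have hcont : ∀ p, Continuous fun y : EuclideanSpace ℝ (Fin d) => pev p (x + s • y) := fun p =>
    (continuous_pev p).comp (by fun_prop)
  have h2 : 2 * ∫ y, κ (‖y‖ ^ 2) * fderiv ℝ (pev H) (x + s • y) y = ∑ i : Fin d,
      ∫ y : EuclideanSpace ℝ (Fin d),
        κ (‖y‖ ^ 2) * (2 * y i * pev (MvPolynomial.pderiv i H) (x + s • y)) := by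
    rw [← integral_const_mul, ← integral_finsetSum]
    · refine integral_congr_ae (Eventually.of_forall fun y => ?_)
      simp only [fderiv_pev_apply, Finset.mul_sum]
      exact Finset.sum_congr rfl fun i _ => by ring
    · intro i _
      have := hcont (MvPolynomial.pderiv i H)
      exact integrable_radial_mul hκ hρ hκ0 (by fun_prop)
  have h3 : ∑ i : Fin d, ∫ y : EuclideanSpace ℝ (Fin d), K (‖y‖ ^ 2) *
        (s * pev (MvPolynomial.pderiv i (MvPolynomial.pderiv i H)) (x + s • y)) = 0 := by
    rw [← integral_finsetSum]
    · have : ∀ y : EuclideanSpace ℝ (Fin d), ∑ i : Fin d, K (‖y‖ ^ 2) *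
          (s * pev (MvPolynomial.pderiv i (MvPolynomial.pderiv i H)) (x + s • y)) = 0 := fun y => by
        rw [← Finset.mul_sum, ← Finset.mul_sum]
        have : ∑ i : Fin d, pev (MvPolynomial.pderiv i (MvPolynomial.pderiv i H)) (x + s • y) =
            pev (polyLapl d H) (x + s • y) := by
          simp [polyLapl_apply, pev]
        rw [this, hH]
        simp [pev]
      simp [this]
    · intro i _
      have := hcont (MvPolynomial.pderiv i (MvPolynomial.pderiv i H))
      exact integrable_radial_mul hKc hρ hK0 (by fun_prop)
  simp_rw [hparts, Finset.sum_neg_distrib, h3] at h2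
  linarith

/-- The mean value property of harmonic polynomials for radial weights. -/
theorem integral_radial_mul_harmonic (hκ : Continuous κ) (hρ : 0 ≤ ρ)
    (hκ0 : ∀ s, ρ ^ 2 ≤ s → κ s = 0) {H : MvPolynomial (Fin d) ℝ} (hH : polyLapl d H = 0)
    (x : EuclideanSpace ℝ (Fin d)) :
    ∫ y, κ (‖y‖ ^ 2) * pev H (x + y) = pev H x * ∫ y : EuclideanSpace ℝ (Fin d), κ (‖y‖ ^ 2) := by
  set F : ℝ → EuclideanSpace ℝ (Fin d) → ℝ := fun s y => κ (‖y‖ ^ 2) * pev H (x + s • y)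
  set F' : ℝ → EuclideanSpace ℝ (Fin d) → ℝ :=
    fun s y => κ (‖y‖ ^ 2) * fderiv ℝ (pev H) (x + s • y) y
  have hHc := continuous_pev H
  have hfc : Continuous fun z : ℝ × EuclideanSpace ℝ (Fin d) =>
      fderiv ℝ (pev H) (x + z.1 • z.2) z.2 := by
    simp_rw [fderiv_pev_apply]
    refine continuous_finsetSum _ fun i _ => ?_
    have := continuous_pev (MvPolynomial.pderiv i H)
    fun_prop
  have hder : ∀ s, HasDerivAt (fun s => ∫ y, F s y) 0 s := by
    intro s
    obtain ⟨M, hM⟩ := ((isCompact_closedBall s 1).prod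
      (isCompact_closedBall (0 : EuclideanSpace ℝ (Fin d)) ρ)).exists_bound_of_continuousOn
      (f := fun z : ℝ × EuclideanSpace ℝ (Fin d) => F' z.1 z.2) (by
        have : Continuous fun z : ℝ × EuclideanSpace ℝ (Fin d) => F' z.1 z.2 := by
          have h : Continuous fun z : ℝ × EuclideanSpace ℝ (Fin d) => κ (‖z.2‖ ^ 2) := by fun_prop
          exact h.mul hfc
        exact this.continuousOn)
    have := (hasDerivAt_integral_of_dominated_loc_of_deriv_le (μ := volume) (F := F) (F' := F')
      (x₀ := s) (s := closedBall s 1)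
      (bound := (closedBall (0 : EuclideanSpace ℝ (Fin d)) ρ).indicator fun _ => M)
      (closedBall_mem_nhds s one_pos)
      (Eventually.of_forall fun t => (Continuous.aestronglyMeasurable (by
        simp only [F]; fun_prop)))
      (integrable_radial_mul hκ hρ hκ0 (by fun_prop))
      (Continuous.aestronglyMeasurable (by
        have : Continuous fun y : EuclideanSpace ℝ (Fin d) => fderiv ℝ (pev H) (x + s • y) y :=
          hfc.comp (by fun_prop : Continuous fun y : EuclideanSpace ℝ (Fin d) => (s, y))
        simp only [F']; fun_prop))
      (Eventually.of_forall fun y t ht => by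
        by_cases hy : y ∈ closedBall (0 : EuclideanSpace ℝ (Fin d)) ρ
        · rw [indicator_of_mem hy]
          exact hM (t, y) ⟨ht, hy⟩
        · rw [indicator_of_notMem hy]
          rw [mem_closedBall, dist_zero_right, not_le] at hy
          simp only [F']
          rw [hκ0 _ (pow_le_pow_left₀ hρ hy.le 2)]
          simp)
      ((integrable_indicator_iff measurableSet_closedBall).2
        (integrableOn_const (measure_closedBall_lt_top).ne))
      (Eventually.of_forall fun y t _ => by
        have h1 : HasDerivAt (fun t : ℝ => x + t • y) y t := by
          simpa using ((hasDerivAt_id t).smul_const y).const_add x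
        exact (((contDiff_pev (k := 1) H).differentiable (by norm_num)
          (x + t • y)).hasFDerivAt.comp_hasDerivAt t h1).const_mul _)).2
    rwa [integral_radial_mul_fderiv_eq_zero hκ hρ hκ0 hH x s] at this
  have hconst := is_const_of_deriv_eq_zero (fun s => (hder s).differentiableAt)
    (fun s => (hder s).deriv) 1 0
  simp only [F, one_smul, zero_smul, add_zero] at hconst
  rw [hconst, integral_mul_const, mul_comm]

end RadialMeanValue

section SphericalMeans

variable {d : ℕ}

/-- The surface measure of the unit sphere of `ℝ^d`. -/
abbrev sphMeas (d : ℕ) : Measure (sphere (0 : EuclideanSpace ℝ (Fin d)) 1) :=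
  (volume : Measure (EuclideanSpace ℝ (Fin d))).toSphere

/-- The (unnormalized) integral of `F` over the sphere of radius `r` centred at `x`. -/
def sphInt (F : EuclideanSpace ℝ (Fin d) → ℝ) (x : EuclideanSpace ℝ (Fin d)) (r : ℝ) : ℝ :=
  ∫ θ, F (x + r • (θ : EuclideanSpace ℝ (Fin d))) ∂sphMeas d

lemma integrable_sphMeas {F : EuclideanSpace ℝ (Fin d) → ℝ} (hF : Continuous F)
    (x : EuclideanSpace ℝ (Fin d)) (r : ℝ) :
    Integrable (fun θ : sphere (0 : EuclideanSpace ℝ (Fin d)) 1 =>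
      F (x + r • (θ : EuclideanSpace ℝ (Fin d)))) (sphMeas d) := by
  have : Continuous fun θ : sphere (0 : EuclideanSpace ℝ (Fin d)) 1 =>
      F (x + r • (θ : EuclideanSpace ℝ (Fin d))) := by fun_prop
  exact Continuous.integrable_of_hasCompactSupport this (HasCompactSupport.of_compactSpace _)

lemma continuous_sphInt {F : EuclideanSpace ℝ (Fin d) → ℝ} (hF : Continuous F)
    (x : EuclideanSpace ℝ (Fin d)) : Continuous (sphInt F x) := by
  have h : Continuous fun z : ℝ × sphere (0 : EuclideanSpace ℝ (Fin d)) 1 =>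
      F (x + z.1 • (z.2 : EuclideanSpace ℝ (Fin d))) := by fun_prop
  have := continuous_parametric_integral_of_continuous (μ := sphMeas d)
    (f := fun (r : ℝ) (θ : sphere (0 : EuclideanSpace ℝ (Fin d)) 1) =>
      F (x + r • (θ : EuclideanSpace ℝ (Fin d)))) h (s := univ) isCompact_univ
  rw [Measure.restrict_univ] at this
  exact this

variable [NeZero d]

lemma sphMeas_real_univ_pos : 0 < (sphMeas d).real univ := by
  have : sphMeas d ≠ 0 := by
    exact Measure.toSphere_ne_zero _
  rw [measureReal_def, ENNReal.toReal_pos_iff]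
  exact ⟨Measure.measure_univ_pos.2 this, measure_lt_top _ _⟩

lemma integral_eq_integral_polar {g : EuclideanSpace ℝ (Fin d) → ℝ} (hg : Integrable g) :
    ∫ y, g y = ∫ r : Ioi (0 : ℝ), ∫ θ, g ((r : ℝ) • (θ : EuclideanSpace ℝ (Fin d))) ∂sphMeas d
      ∂Measure.volumeIoiPow (Module.finrank ℝ (EuclideanSpace ℝ (Fin d)) - 1) := by
  have hmp := (volume : Measure (EuclideanSpace ℝ (Fin d))).measurePreserving_homeomorphUnitSphereProd
  have hme := (homeomorphUnitSphereProd (EuclideanSpace ℝ (Fin d))).measurableEmbedding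
  set G := fun z : sphere (0 : EuclideanSpace ℝ (Fin d)) 1 × Ioi (0 : ℝ) =>
    g ((z.2 : ℝ) • (z.1 : EuclideanSpace ℝ (Fin d)))
  have hGe : ∀ y, G (homeomorphUnitSphereProd (EuclideanSpace ℝ (Fin d)) y) = g y := by
    intro y
    have := congrArg Subtype.val ((homeomorphUnitSphereProd (EuclideanSpace ℝ (Fin d))).symm_apply_apply y)
    rw [homeomorphUnitSphereProd_symm_apply_coe] at this
    simp only [G, this]
  have hi : Integrable (fun y : ({(0)}ᶜ : Set (EuclideanSpace ℝ (Fin d))) => g y)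
      (volume.comap Subtype.val) := by
    have := (integrableOn_iff_comap_subtypeVal (measurableSet_singleton _).compl).1
      (hg.integrableOn (s := ({0}ᶜ : Set (EuclideanSpace ℝ (Fin d)))))
    exact this
  have hG : Integrable G ((sphMeas d).prod
      (Measure.volumeIoiPow (Module.finrank ℝ (EuclideanSpace ℝ (Fin d)) - 1))) := by
    rw [← hmp.integrable_comp_emb hme]
    exact hi.congr (Eventually.of_forall fun y => (hGe y).symm)
  have h1 := hmp.integral_comp hme G
  rw [integral_prod_symm _ hG] at h1
  rw [← h1]
  simp_rw [hGe]
  rw [integral_subtype_comap (measurableSet_singleton _).compl (fun y => g y),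
    restrict_compl_singleton]

/-- Integrating against a radial weight factors through spherical means. -/
lemma integral_radial_mul_sphInt {k : ℝ → ℝ} {F : EuclideanSpace ℝ (Fin d) → ℝ}
    (x : EuclideanSpace ℝ (Fin d)) (h1 : Integrable fun y => k ‖y‖ * F (x + y))
    (h2 : Integrable fun y : EuclideanSpace ℝ (Fin d) => k ‖y‖ * sphInt F x ‖y‖) :
    ∫ y : EuclideanSpace ℝ (Fin d), k ‖y‖ * sphInt F x ‖y‖ =
      (sphMeas d).real univ * ∫ y, k ‖y‖ * F (x + y) := by
  have hn : ∀ (r : Ioi (0 : ℝ)) (θ : sphere (0 : EuclideanSpace ℝ (Fin d)) 1),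
      ‖(r : ℝ) • (θ : EuclideanSpace ℝ (Fin d))‖ = r := fun r θ => by
    rw [norm_smul, norm_eq_of_mem_sphere, mul_one, Real.norm_of_nonneg (le_of_lt r.2)]
  rw [integral_eq_integral_polar h1, integral_eq_integral_polar h2]
  simp_rw [hn, integral_const_mul, integral_const, smul_eq_mul]
  rw [← integral_const_mul]
  simp only [sphInt, mul_left_comm]

/-- The mean value property of harmonic polynomials on spheres. -/
theorem sphInt_pev_of_harmonic {H : MvPolynomial (Fin d) ℝ} (hH : polyLapl d H = 0)
    (x : EuclideanSpace ℝ (Fin d)) {r : ℝ} (hr : 0 ≤ r) :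
    sphInt (pev H) x r = (sphMeas d).real univ * pev H x := by
  set S := (sphMeas d).real univ
  have hHc := continuous_pev H
  have hm := continuous_sphInt hHc x
  set e : ℝ → ℝ := fun r => sphInt (pev H) x r - S * pev H x
  have he : Continuous e := hm.sub continuous_const
  set τ : ℝ → ℝ := fun s => max 0 ((r + 1) ^ 2 - s)
  have hτ : Continuous τ := by fun_prop
  have hτ0 : ∀ s, (r + 1) ^ 2 ≤ s → τ s = 0 := fun s hs => max_eq_left (by linarith)
  set κ : ℝ → ℝ := fun s => τ s * e √s
  have hκ : Continuous κ := hτ.mul (he.comp Real.continuous_sqrt)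
  have hκ0 : ∀ s, (r + 1) ^ 2 ≤ s → κ s = 0 := fun s hs => by simp only [κ]; rw [hτ0 s hs, zero_mul]
  have hr1 : 0 ≤ r + 1 := by linarith
  have i1 : Integrable fun y : EuclideanSpace ℝ (Fin d) => κ (‖y‖ ^ 2) * pev H (x + y) :=
    integrable_radial_mul hκ hr1 hκ0 (by fun_prop)
  have i2 : Integrable fun y : EuclideanSpace ℝ (Fin d) => κ (‖y‖ ^ 2) * sphInt (pev H) x ‖y‖ :=
    integrable_radial_mul hκ hr1 hκ0 (by fun_prop)
  have i3 : Integrable fun y : EuclideanSpace ℝ (Fin d) => κ (‖y‖ ^ 2) := by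
    simpa using integrable_radial_mul hκ hr1 hκ0 (g := fun _ : EuclideanSpace ℝ (Fin d) => (1 : ℝ))
      continuous_const
  have h1 := integral_radial_mul_sphInt (k := fun s => κ (s ^ 2)) (F := pev H) x i1 i2
  rw [integral_radial_mul_harmonic hκ hr1 hκ0 hH] at h1
  have h2 : ∫ y : EuclideanSpace ℝ (Fin d), τ (‖y‖ ^ 2) * (e ‖y‖) ^ 2 = 0 := by
    have : ∀ y : EuclideanSpace ℝ (Fin d), τ (‖y‖ ^ 2) * (e ‖y‖) ^ 2 =
        κ (‖y‖ ^ 2) * sphInt (pev H) x ‖y‖ - (S * pev H x) * κ (‖y‖ ^ 2) := fun y => by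
      simp only [κ, Real.sqrt_sq (norm_nonneg y), e]; ring
    simp_rw [this]
    rw [integral_sub i2 (i3.const_mul _), h1, integral_const_mul]
    ring
  by_contra hne
  obtain ⟨v, hv⟩ := exists_norm_eq (EuclideanSpace ℝ (Fin d)) hr
  have hpos := Continuous.integral_pos_of_hasCompactSupport_nonneg_nonzero
    (μ := (volume : Measure (EuclideanSpace ℝ (Fin d))))
    (f := fun y => τ (‖y‖ ^ 2) * (e ‖y‖) ^ 2) (by fun_prop)
    (hasCompactSupport_radial_mul hr1 hτ0 _)
    (fun y => mul_nonneg (le_max_left _ _) (sq_nonneg _)) (x := v) (by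
      rw [hv]
      refine mul_ne_zero (lt_max_of_lt_right (by nlinarith)).ne' (pow_ne_zero 2 (sub_ne_zero.2 hne)))
  exact hpos.ne' h2

/-- The super mean value property on spheres implies the one on balls. -/
lemma superMeanVal_of_sphInt_le {F : EuclideanSpace ℝ (Fin d) → ℝ} (hF : Continuous F)
    (h : ∀ x r, 0 < r → sphInt F x r ≤ (sphMeas d).real univ * F x) : SuperMeanVal d F := by
  intro x r hr
  set S := (sphMeas d).real univ
  have hS : 0 < S := sphMeas_real_univ_pos
  have hm := continuous_sphInt hF x
  set k : ℝ → ℝ := (Iio r).indicator 1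
  have hk : ∀ g : EuclideanSpace ℝ (Fin d) → ℝ, (fun y : EuclideanSpace ℝ (Fin d) => k ‖y‖ * g y) =
      (ball 0 r).indicator g := fun g => by
    ext y
    by_cases hy : ‖y‖ < r
    · simp [k, indicator, hy]
    · simp [k, indicator, hy]
  have hint : ∀ g : EuclideanSpace ℝ (Fin d) → ℝ, Continuous g → IntegrableOn g (ball 0 r) :=
    fun g hg => (hg.continuousOn.integrableOn_compact (isCompact_closedBall 0 r)).mono_set
      ball_subset_closedBall
  have i1 : Integrable fun y => k ‖y‖ * F (x + y) := by
    rw [hk (fun y => F (x + y)), integrable_indicator_iff measurableSet_ball]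
    exact hint _ (by fun_prop)
  have i2 : Integrable fun y : EuclideanSpace ℝ (Fin d) => k ‖y‖ * sphInt F x ‖y‖ := by
    rw [hk (fun y => sphInt F x ‖y‖), integrable_indicator_iff measurableSet_ball]
    exact hint _ (by fun_prop)
  have h1 := integral_radial_mul_sphInt x i1 i2
  rw [hk (fun y => F (x + y)), hk (fun y => sphInt F x ‖y‖), integral_indicator measurableSet_ball,
    integral_indicator measurableSet_ball] at h1
  have h2 : ∫ y in ball (0 : EuclideanSpace ℝ (Fin d)) r, sphInt F x ‖y‖ ≤
      ∫ y in ball (0 : EuclideanSpace ℝ (Fin d)) r, S * F x := by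
    refine setIntegral_mono_on_ae (hint _ (by fun_prop)) (hint _ continuous_const) measurableSet_ball ?_
    filter_upwards [compl_mem_ae_iff.2 (measure_singleton (0 : EuclideanSpace ℝ (Fin d)))] with y hy _
    exact h x _ (norm_pos_iff.2 hy)
  have h3 : ∫ y in ball (0 : EuclideanSpace ℝ (Fin d)) r, F (x + y) = ∫ y in ball x r, F y := by
    have := (measurePreserving_add_left (volume : Measure (EuclideanSpace ℝ (Fin d))) x).setIntegral_preimage_emb
      (MeasurableEquiv.addLeft x).measurableEmbedding F (ball x r)
    rw [← this]
    congr 2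
    ext y
    simp
  have hvol : volume.real (ball (0 : EuclideanSpace ℝ (Fin d)) r) = volume.real (ball x r) := by
    simp [measureReal_def, Measure.addHaar_ball_center _ x]
  have hvp : 0 < volume.real (ball x r) := by
    rw [measureReal_def, ENNReal.toReal_pos_iff]
    exact ⟨measure_ball_pos _ _ hr, measure_ball_lt_top⟩
  rw [h1, h3, setIntegral_const, hvol, smul_eq_mul] at h2
  rw [setAverage_eq, smul_eq_mul, inv_mul_le_iff₀ hvp]
  nlinarith

end SphericalMeans

section DirichletProblem

variable {d : ℕ}

lemma continuousAt_lapl {f : EuclideanSpace ℝ (Fin d) → ℝ} {x : EuclideanSpace ℝ (Fin d)}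
    (hf : ContDiffAt ℝ 2 f x) : ContinuousAt (lapl d f) x := by
  have h1 : lapl d f =ᶠ[nhds x] fun y => ∑ i : Fin d, fderiv ℝ (fderiv ℝ f) y
      (EuclideanSpace.single i 1) (EuclideanSpace.single i 1) :=
    (hf.eventually (by simp)).mono fun y hy => lapl_eq_sum_fderiv_fderiv hy
  have h2 : ContDiffAt ℝ 1 (fderiv ℝ f) x := hf.fderiv_right (by norm_num)
  have h3 : ContinuousAt (fderiv ℝ (fderiv ℝ f)) x :=
    (h2.fderiv_right (m := 0) (by norm_num)).continuousAt
  refine ContinuousAt.congr ?_ h1.symm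
  exact tendsto_finsetSum _ fun i _ =>
    (h3.clm_apply continuousAt_const).clm_apply continuousAt_const

lemma exists_pev_near {K : Set (EuclideanSpace ℝ (Fin d))} (hK : IsCompact K)
    {g : EuclideanSpace ℝ (Fin d) → ℝ} (hg : Continuous g) {ε : ℝ} (hε : 0 < ε) :
    ∃ P : MvPolynomial (Fin d) ℝ, ∀ x ∈ K, |pev P x - g x| < ε := by
  have : CompactSpace K := isCompact_iff_compactSpace.1 hK
  let Φ : MvPolynomial (Fin d) ℝ →ₐ[ℝ] C(K, ℝ) :=
    MvPolynomial.aeval fun i => ⟨fun x => (x : EuclideanSpace ℝ (Fin d)) i, by fun_prop⟩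
  have hΦ : ∀ P (x : K), Φ P x = pev P (x : EuclideanSpace ℝ (Fin d)) := by
    intro P x
    induction P using MvPolynomial.induction_on with
    | C a => simp [Φ, pev]
    | add p q hp hq => rw [map_add, ContinuousMap.add_apply, hp, hq, pev_add]
    | mul_X p i hp => rw [map_mul, ContinuousMap.mul_apply, hp, pev_mul, pev_X]; simp [Φ]
  have hsep : Φ.range.SeparatesPoints := by
    intro x y hxy
    obtain ⟨i, hi⟩ : ∃ i, (x : EuclideanSpace ℝ (Fin d)) i ≠ (y : EuclideanSpace ℝ (Fin d)) i := by
      by_contra! h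
      exact hxy (Subtype.ext (PiLp.ext h))
    exact ⟨Φ (MvPolynomial.X i), ⟨_, ⟨MvPolynomial.X i, rfl⟩, rfl⟩, by simpa [hΦ, pev_X] using hi⟩
  obtain ⟨⟨_, P, rfl⟩, hP⟩ := ContinuousMap.exists_mem_subalgebra_near_continuousMap_of_separatesPoints
    Φ.range hsep ⟨fun x : K => g x, by fun_prop⟩ ε hε
  refine ⟨P, fun x hx => ?_⟩
  have := (ContinuousMap.norm_lt_iff _ hε).1 hP ⟨x, hx⟩
  rw [← hΦ P ⟨x, hx⟩]
  exact this

lemma lapl_pev_of_harmonic {H : MvPolynomial (Fin d) ℝ} (hH : polyLapl d H = 0)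
    (x : EuclideanSpace ℝ (Fin d)) : lapl d (pev H) x = 0 := by
  rw [lapl_pev, hH]; simp [pev]

variable {c : EuclideanSpace ℝ (Fin d)} {r : ℝ}

/-- `h` is a uniform limit of harmonic polynomials on `closedBall c r`. -/
def IsHarmonicLimit (c : EuclideanSpace ℝ (Fin d)) (r : ℝ) (h : EuclideanSpace ℝ (Fin d) → ℝ) :
    Prop :=
  ∀ ε > 0, ∃ H : MvPolynomial (Fin d) ℝ, polyLapl d H = 0 ∧
    ∀ x ∈ closedBall c r, |pev H x - h x| ≤ ε

lemma IsHarmonicLimit.neg {h : EuclideanSpace ℝ (Fin d) → ℝ} (hh : IsHarmonicLimit c r h) :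
    IsHarmonicLimit c r (fun x => -h x) := by
  intro ε hε
  obtain ⟨H, hH, hHh⟩ := hh ε hε
  refine ⟨-H, by rw [map_neg, hH, neg_zero], fun x hx => ?_⟩
  have : pev (-H) x = -pev H x := by simp [pev]
  rw [this, ← neg_sub', abs_neg]
  exact hHh x hx

lemma IsHarmonicLimit.continuousOn {h : EuclideanSpace ℝ (Fin d) → ℝ}
    (hh : IsHarmonicLimit c r h) : ContinuousOn h (closedBall c r) := by
  refine Metric.continuousOn_iff.2 fun x hx ε hε => ?_
  obtain ⟨H, -, hHh⟩ := hh (ε / 3) (by positivity)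
  obtain ⟨δ, hδ, hc⟩ := Metric.continuous_iff.1 (continuous_pev H) x (ε / 3) (by positivity)
  refine ⟨δ, hδ, fun y hy hyx => ?_⟩
  have h1 := abs_le.1 (hHh x hx)
  have h2 := abs_le.1 (hHh y hy)
  have h3 := hc y hyx
  rw [Real.dist_eq, abs_lt] at h3 ⊢
  constructor <;> linarith

lemma IsHarmonicLimit.contDiffAt {h : EuclideanSpace ℝ (Fin d) → ℝ} (hh : IsHarmonicLimit c r h)
    {x : EuclideanSpace ℝ (Fin d)} (hx : x ∈ ball c r) : ContDiffAt ℝ 2 h x := by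
  obtain ⟨δ, hδ, hsub⟩ : ∃ δ > 0, closedBall x (2 * δ) ⊆ ball c r := by
    obtain ⟨ρ, hρ, hsub⟩ := Metric.isOpen_iff.1 isOpen_ball x hx
    exact ⟨ρ / 3, by positivity, (closedBall_subset_ball (by linarith)).trans hsub⟩
  set κ : ℝ → ℝ := fun s => Real.smoothTransition (δ ^ 2 - s)
  have hκs : ContDiff ℝ 2 κ := Real.smoothTransition.contDiff.comp (by fun_prop)
  have hκ := hκs.continuous
  have hκ0 : ∀ s, δ ^ 2 ≤ s → κ s = 0 := fun s hs =>
    Real.smoothTransition.zero_of_nonpos (by linarith)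
  have hκi : ∀ {g : EuclideanSpace ℝ (Fin d) → ℝ}, Continuous g →
      Integrable fun y => κ (‖y‖ ^ 2) * g y := fun hg => integrable_radial_mul hκ hδ.le hκ0 hg
  set A := ∫ y : EuclideanSpace ℝ (Fin d), κ (‖y‖ ^ 2)
  have hκi1 : Integrable fun y : EuclideanSpace ℝ (Fin d) => κ (‖y‖ ^ 2) := by
    simpa using hκi (g := fun _ => 1) continuous_const
  have hκn : ∀ s, 0 ≤ κ s := fun s => Real.smoothTransition.nonneg _
  have hA : 0 < A := by
    refine Continuous.integral_pos_of_hasCompactSupport_nonneg_nonzero (x := 0)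
      (by fun_prop) ?_ (fun y => hκn _) ?_
    · simpa using hasCompactSupport_radial_mul hδ.le hκ0 fun _ : EuclideanSpace ℝ (Fin d) => 1
    · exact (Real.smoothTransition.pos_of_pos (by simp; positivity)).ne'
  set h' := (closedBall c r).indicator h
  have hint : Integrable h' := (integrable_indicator_iff measurableSet_closedBall).2
    (hh.continuousOn.integrableOn_compact (isCompact_closedBall c r))
  set k : EuclideanSpace ℝ (Fin d) → ℝ := fun y => κ (‖y‖ ^ 2)
  have hk : ContDiff ℝ 2 k := hκs.comp (contDiff_norm_sq ℝ)
  have hkc : HasCompactSupport k := by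
    simpa using hasCompactSupport_radial_mul hδ.le hκ0 fun _ : EuclideanSpace ℝ (Fin d) => 1
  set cv := convolution h' k (ContinuousLinearMap.mul ℝ ℝ) volume
  have hcv : ContDiff ℝ 2 cv := hkc.contDiff_convolution_right _ hint.locallyIntegrable hk
  have hval : ∀ z ∈ ball x δ, h z = A⁻¹ * cv z := by
    intro z hz
    have hzs : ∀ y : EuclideanSpace ℝ (Fin d), ‖y‖ < δ → z + y ∈ closedBall c r := fun y hy => by
      refine ball_subset_closedBall (hsub ?_)
      rw [mem_closedBall, dist_eq_norm]
      rw [mem_ball, dist_eq_norm] at hz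
      calc ‖z + y - x‖ = ‖(z - x) + y‖ := by congr 1; abel
        _ ≤ ‖z - x‖ + ‖y‖ := norm_add_le _ _
        _ ≤ 2 * δ := by linarith
    have hz0 : z ∈ closedBall c r := by simpa using hzs 0 (by simpa using hδ)
    have e1 : cv z = ∫ y, κ (‖y‖ ^ 2) * h' (z + y) := by
      simp only [cv, convolution_def, ContinuousLinearMap.mul_apply']
      rw [← integral_add_left_eq_self _ z]
      refine integral_congr_ae (Eventually.of_forall fun y => ?_)
      simp only [k, sub_add_cancel_left, norm_neg]
      ring
    have hint2 : Integrable fun y => κ (‖y‖ ^ 2) * h' (z + y) := by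
      obtain ⟨M, hM⟩ := (isCompact_closedBall (0 : ℝ) (δ ^ 2)).exists_bound_of_continuousOn
        hκ.continuousOn
      refine (hint.comp_add_left z).bdd_mul (c := M) (by fun_prop) (Eventually.of_forall fun y => ?_)
      by_cases hy : ‖y‖ ^ 2 ≤ δ ^ 2
      · exact hM _ (by simpa using hy)
      · rw [hκ0 _ (not_le.1 hy).le, norm_zero]
        exact (norm_nonneg _).trans (hM 0 (by simp; positivity))
    have key : ∀ ε > 0, |cv z - A * h z| ≤ 2 * A * ε := by
      intro ε hε
      obtain ⟨H, hH, hHh⟩ := hh ε hε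
      have h1 := integral_radial_mul_harmonic hκ hδ.le hκ0 hH z
      have hHc := continuous_pev H
      have h2 : |cv z - pev H z * A| ≤ A * ε := by
        have h4 : A * ε = ∫ y : EuclideanSpace ℝ (Fin d), κ (‖y‖ ^ 2) * ε :=
          (integral_mul_const _ _).symm
        rw [e1, ← h1, ← integral_sub hint2 (hκi (by fun_prop)), h4, ← Real.norm_eq_abs]
        refine norm_integral_le_of_norm_le (hκi1.mul_const _) (Eventually.of_forall fun y => ?_)
        by_cases hy : ‖y‖ < δ
        · have h3 := hHh _ (hzs y hy)
          rw [← mul_sub, norm_mul, Real.norm_of_nonneg (hκn _)]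
          refine mul_le_mul_of_nonneg_left ?_ (hκn _)
          simp only [h', indicator_of_mem (hzs y hy)]
          rwa [Real.norm_eq_abs, abs_sub_comm]
        · rw [hκ0 _ (pow_le_pow_left₀ hδ.le (not_lt.1 hy) 2)]
          simp
      have h3 := abs_le.1 (hHh z hz0)
      rw [abs_le] at h2 ⊢
      constructor <;> nlinarith
    have h0 : cv z - A * h z = 0 := by
      by_contra hne
      have hp := abs_pos.2 hne
      have := key (|cv z - A * h z| / (4 * A)) (by positivity)
      have e : 2 * A * (|cv z - A * h z| / (4 * A)) = |cv z - A * h z| / 2 := by field_simp; ring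
      linarith
    field_simp
    linarith
  have : ContDiffAt ℝ 2 (fun z => A⁻¹ * cv z) x := contDiffAt_const.mul hcv.contDiffAt
  refine this.congr_of_eventuallyEq ?_
  filter_upwards [ball_mem_nhds x hδ] with z hz using hval z hz

variable [NeZero d]

lemma exists_harmonic_polynomial_near (hr : 0 < r) {g : EuclideanSpace ℝ (Fin d) → ℝ}
    (hg : Continuous g) {ε : ℝ} (hε : 0 < ε) :
    ∃ H : MvPolynomial (Fin d) ℝ, polyLapl d H = 0 ∧ ∀ x ∈ sphere c r, |pev H x - g x| < ε := by
  obtain ⟨P, hP⟩ := exists_pev_near (isCompact_sphere c r) hg hε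
  obtain ⟨H, hH, hHP⟩ := exists_harmonic_polynomial_eq_on_sphere P c hr
  exact ⟨H, hH, fun x hx => by rw [hHP x hx]; exact hP x hx⟩

/-- The comparison principle on balls. -/
lemma le_on_closedBall_of_lapl_le (hr : 0 < r) {f g : EuclideanSpace ℝ (Fin d) → ℝ}
    (hfc : ContinuousOn f (closedBall c r)) (hgc : ContinuousOn g (closedBall c r))
    (hf : ∀ x ∈ ball c r, ContDiffAt ℝ 2 f x) (hg : ∀ x ∈ ball c r, ContDiffAt ℝ 2 g x)
    (hl : ∀ x ∈ ball c r, lapl d g x ≤ lapl d f x) (hs : ∀ x ∈ sphere c r, f x ≤ g x) :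
    ∀ x ∈ closedBall c r, f x ≤ g x := by
  have h := le_zero_of_lapl_nonneg (f := fun x => f x - g x) (U := ball c r) isOpen_ball
    isBounded_ball (by rw [closure_ball c hr.ne']; exact hfc.sub hgc)
    (fun x hx => (hf x hx).sub (hg x hx))
    (fun x hx => by rw [lapl_sub (hf x hx) (hg x hx)]; linarith [hl x hx])
    (fun x hx => by rw [frontier_ball c hr.ne'] at hx; linarith [hs x hx])
  rw [closure_ball c hr.ne'] at h
  exact fun x hx => by linarith [h x hx]

lemma pev_le_add_of_harmonic (hr : 0 < r) {H K : MvPolynomial (Fin d) ℝ} (hH : polyLapl d H = 0)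
    (hK : polyLapl d K = 0) {ε : ℝ} (hs : ∀ x ∈ sphere c r, pev H x ≤ pev K x + ε) :
    ∀ x ∈ closedBall c r, pev H x ≤ pev K x + ε := by
  refine le_on_closedBall_of_lapl_le hr (continuous_pev H).continuousOn
    ((continuous_pev K).add continuous_const).continuousOn (fun x _ => (contDiff_pev H).contDiffAt)
    (fun x _ => (contDiff_pev K).contDiffAt.add contDiffAt_const) (fun x _ => ?_) hs
  rw [lapl_add (contDiff_pev K).contDiffAt contDiffAt_const, lapl_const,
    lapl_pev_of_harmonic hH, lapl_pev_of_harmonic hK, add_zero]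

lemma IsHarmonicLimit.lapl_nonpos {h : EuclideanSpace ℝ (Fin d) → ℝ} (hh : IsHarmonicLimit c r h)
    {x : EuclideanSpace ℝ (Fin d)} (hx : x ∈ ball c r) : lapl d h x ≤ 0 := by
  by_contra! hpos
  have hd : (0 : ℝ) < d := by exact_mod_cast NeZero.pos d
  obtain ⟨ρ, hρ, hsub⟩ := Metric.mem_nhds_iff.1 (inter_mem (isOpen_ball.mem_nhds hx)
    ((continuousAt_lapl (hh.contDiffAt hx)).eventually (lt_mem_nhds (half_lt_self hpos))))
  set s := ρ / 2
  have hs : 0 < s := by positivity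
  have hsub' : closedBall x s ⊆ ball x ρ := closedBall_subset_ball (by simp only [s]; linarith)
  set η := lapl d h x / (4 * d)
  have hη : 0 < η := by positivity
  obtain ⟨H, hH, hHh⟩ := hh (η * s ^ 2 / 4) (by positivity)
  have hq : ∀ y : EuclideanSpace ℝ (Fin d),
      ContDiffAt ℝ 2 (fun y => η * ‖y - x‖ ^ 2 + (η * s ^ 2 / 4 - η * s ^ 2)) y := fun y =>
    (contDiffAt_const.mul (contDiff_sq_dist x).contDiffAt).add contDiffAt_const
  have hB : ∀ y ∈ closedBall x s, y ∈ closedBall c r := fun y hy =>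
    ball_subset_closedBall (hsub (hsub' hy)).1
  have h1 := le_on_closedBall_of_lapl_le (c := x) hs (f := h)
    (g := fun y => pev H y + (η * ‖y - x‖ ^ 2 + (η * s ^ 2 / 4 - η * s ^ 2)))
    (hh.continuousOn.mono hB)
    (fun y _ => ((contDiff_pev (k := 2) H).contDiffAt.add (hq y)).continuousAt.continuousWithinAt)
    (fun y hy => hh.contDiffAt (hsub (hsub' (ball_subset_closedBall hy))).1)
    (fun y _ => (contDiff_pev H).contDiffAt.add (hq y))
    (fun y hy => by
      rw [lapl_add (contDiff_pev H).contDiffAt (hq y), lapl_pev_of_harmonic hH,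
        lapl_add (contDiffAt_const.mul (contDiff_sq_dist x).contDiffAt) contDiffAt_const,
        lapl_const_mul _ (contDiff_sq_dist x).contDiffAt, lapl_sq_dist, lapl_const]
      have h2 := (hsub (hsub' (ball_subset_closedBall hy))).2
      have h3 : η * (2 * d) = lapl d h x / 2 := by simp only [η]; field_simp; ring
      rw [mem_ofPred_eq] at h2
      linarith)
    (fun y hy => by
      have h2 := abs_le.1 (hHh y (hB y (sphere_subset_closedBall hy)))
      rw [mem_sphere, dist_eq_norm] at hy
      rw [hy]
      linarith) x (mem_closedBall_self hs.le)
  have h2 := abs_le.1 (hHh x (hB x (mem_closedBall_self hs.le)))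
  have h3 : 0 < η * s ^ 2 := by positivity
  simp only [sub_self, norm_zero] at h1
  nlinarith

lemma IsHarmonicLimit.lapl_eq_zero {h : EuclideanSpace ℝ (Fin d) → ℝ}
    (hh : IsHarmonicLimit c r h) {x : EuclideanSpace ℝ (Fin d)} (hx : x ∈ ball c r) :
    lapl d h x = 0 := by
  have h1 := hh.neg.lapl_nonpos hx
  rw [lapl_neg (hh.contDiffAt hx)] at h1
  linarith [hh.lapl_nonpos hx]

/-- The Dirichlet problem on balls with continuous data. -/
theorem exists_isHarmonicLimit_eq_on_sphere (c : EuclideanSpace ℝ (Fin d)) (hr : 0 < r)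
    {g : EuclideanSpace ℝ (Fin d) → ℝ} (hg : Continuous g) :
    ∃ h, IsHarmonicLimit c r h ∧ ∀ x ∈ sphere c r, h x = g x := by
  have hpos : ∀ k : ℕ, (0 : ℝ) < 1 / (k + 1) := fun k => by positivity
  choose H hH hHg using fun k : ℕ =>
    exists_harmonic_polynomial_near (c := c) hr hg (hpos k)
  have hle : ∀ k l x, x ∈ closedBall c r →
      pev (H k) x ≤ pev (H l) x + (1 / (k + 1) + 1 / (l + 1)) := fun k l =>
    pev_le_add_of_harmonic hr (hH k) (hH l) fun x hx => by
      have h1 := abs_lt.1 (hHg k x hx)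
      have h2 := abs_lt.1 (hHg l x hx)
      linarith
  have hlim0 : Tendsto (fun k : ℕ => (1 : ℝ) / (k + 1)) atTop (nhds 0) :=
    tendsto_one_div_add_atTop_nhds_zero_nat
  have hex : ∀ x, ∃ y, x ∈ closedBall c r → Tendsto (fun k => pev (H k) x) atTop (nhds y) := by
    intro x
    by_cases hx : x ∈ closedBall c r
    · have hcs : CauchySeq fun k => pev (H k) x := by
        refine cauchySeq_of_le_tendsto_0 (fun k : ℕ => 2 * (1 / ((k : ℝ) + 1)))
          (fun k l N hk hl => ?_) (by simpa using hlim0.const_mul 2)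
        have h1 := Nat.one_div_le_one_div (α := ℝ) hk
        have h2 := Nat.one_div_le_one_div (α := ℝ) hl
        rw [Real.dist_eq, abs_le]
        constructor <;> linarith [hle k l x hx, hle l k x hx]
      obtain ⟨y, hy⟩ := cauchySeq_tendsto_of_complete hcs
      exact ⟨y, fun _ => hy⟩
    · exact ⟨0, fun h => absurd h hx⟩
  choose h hh using hex
  refine ⟨h, fun ε hε => ?_, fun x hx => ?_⟩
  · obtain ⟨k, hk⟩ := exists_nat_one_div_lt hε
    refine ⟨H k, hH k, fun x hx => ?_⟩
    have t1 : Tendsto (fun l : ℕ => pev (H l) x + (1 / ((k : ℝ) + 1) + 1 / ((l : ℝ) + 1))) atTop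
        (nhds (h x + (1 / ((k : ℝ) + 1) + 0))) := (hh x hx).add (tendsto_const_nhds.add hlim0)
    have t2 : Tendsto (fun l : ℕ => pev (H l) x - (1 / ((l : ℝ) + 1) + 1 / ((k : ℝ) + 1))) atTop
        (nhds (h x - (0 + 1 / ((k : ℝ) + 1)))) := (hh x hx).sub (hlim0.add tendsto_const_nhds)
    have h1 := ge_of_tendsto' t1 fun l => hle k l x hx
    have h2 := le_of_tendsto' t2 fun l => (by linarith [hle l k x hx] :
      pev (H l) x - (1 / ((l : ℝ) + 1) + 1 / ((k : ℝ) + 1)) ≤ pev (H k) x)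
    rw [abs_le]
    constructor <;> linarith
  · refine tendsto_nhds_unique (hh x (sphere_subset_closedBall hx)) ?_
    rw [tendsto_iff_dist_tendsto_zero]
    exact squeeze_zero (fun _ => dist_nonneg) (fun k => (hHg k x hx).le) hlim0

end DirichletProblem

section SuperharmonicFunctions

variable {d : ℕ}

/-- Continuous functions lying above every `C²` subharmonic function on a ball that they dominate
on its boundary. -/
structure IsSuperharmonic (d : ℕ) (w : EuclideanSpace ℝ (Fin d) → ℝ) : Prop where
  continuous : Continuous w
  le_of_le_on_sphere : ∀ (c : EuclideanSpace ℝ (Fin d)) (r : ℝ), 0 < r →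
    ∀ g : EuclideanSpace ℝ (Fin d) → ℝ, ContinuousOn g (closedBall c r) →
      (∀ x ∈ ball c r, ContDiffAt ℝ 2 g x) → (∀ x ∈ ball c r, 0 ≤ lapl d g x) →
      (∀ x ∈ sphere c r, g x ≤ w x) → ∀ x ∈ closedBall c r, g x ≤ w x

variable {w : EuclideanSpace ℝ (Fin d) → ℝ}

lemma IsSuperharmonic.add_const (hw : IsSuperharmonic d w) (a : ℝ) :
    IsSuperharmonic d fun x => w x + a := by
  refine ⟨hw.continuous.add continuous_const, fun c r hr g hgc hg hl hs x hx => ?_⟩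
  have := hw.le_of_le_on_sphere c r hr (fun x => g x - a) (hgc.sub continuousOn_const)
    (fun x hx => (hg x hx).sub contDiffAt_const)
    (fun x hx => by rw [lapl_sub (hg x hx) contDiffAt_const, lapl_const, sub_zero]; exact hl x hx)
    (fun x hx => by linarith [hs x hx]) x hx
  linarith

lemma IsSuperharmonic.comp_add_right (hw : IsSuperharmonic d w) (a : EuclideanSpace ℝ (Fin d)) :
    IsSuperharmonic d fun x => w (x + a) := by
  refine ⟨hw.continuous.comp (by fun_prop), fun c r hr g hgc hg hl hs x hx => ?_⟩
  have hb : ∀ y, y + -a ∈ ball c r ↔ y ∈ ball (c + a) r := fun y => by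
    rw [mem_ball, mem_ball, dist_eq_norm, dist_eq_norm]; congr! 2; abel
  have hcb : ∀ y, y + -a ∈ closedBall c r ↔ y ∈ closedBall (c + a) r := fun y => by
    rw [mem_closedBall, mem_closedBall, dist_eq_norm, dist_eq_norm]; congr! 2; abel
  have hsp : ∀ y, y + -a ∈ sphere c r ↔ y ∈ sphere (c + a) r := fun y => by
    rw [mem_sphere, mem_sphere, dist_eq_norm, dist_eq_norm]; congr! 2; abel
  have hsm : ContDiff ℝ 2 fun y : EuclideanSpace ℝ (Fin d) => y + -a := by fun_prop
  have := hw.le_of_le_on_sphere (c + a) r hr (fun y => g (y + -a))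
    (hgc.comp (by fun_prop) fun y hy => (hcb y).2 hy)
    (fun y hy => ContDiffAt.comp y (g := g) (hg _ ((hb y).2 hy)) hsm.contDiffAt)
    (fun y hy => by rw [lapl_comp_add_right]; exact hl _ ((hb y).2 hy))
    (fun y hy => by simpa using hs _ ((hsp y).2 hy)) (x + a) ((hcb _).1 (by simpa using hx))
  simpa using this

lemma IsSuperharmonic.add_pev (hw : IsSuperharmonic d w) {p : MvPolynomial (Fin d) ℝ}
    (hp : polyLapl d p = 0) : IsSuperharmonic d fun x => pev p x + w x := by
  refine ⟨(continuous_pev p).add hw.continuous, fun c r hr g hgc hg hl hs x hx => ?_⟩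
  have := hw.le_of_le_on_sphere c r hr (fun x => g x - pev p x)
    (hgc.sub (continuous_pev p).continuousOn) (fun x hx => (hg x hx).sub (contDiff_pev p).contDiffAt)
    (fun x hx => by
      rw [lapl_sub (hg x hx) (contDiff_pev p).contDiffAt, lapl_pev_of_harmonic hp, sub_zero]
      exact hl x hx)
    (fun x hx => by linarith [hs x hx]) x hx
  linarith

lemma lapl_comp_isometry (σ : EuclideanSpace ℝ (Fin d) ≃ₗᵢ[ℝ] EuclideanSpace ℝ (Fin d))
    (hσ : ∀ i, ∃ s : ℝ, s * s = 1 ∧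
      σ (EuclideanSpace.single i 1) = s • EuclideanSpace.single i 1)
    (f : EuclideanSpace ℝ (Fin d) → ℝ) (x : EuclideanSpace ℝ (Fin d)) :
    lapl d (fun y => f (σ y)) x = lapl d f (σ x) := by
  have hch : ∀ (g : EuclideanSpace ℝ (Fin d) → ℝ) (y v : EuclideanSpace ℝ (Fin d)),
      fderiv ℝ (fun y => g (σ y)) y v = fderiv ℝ g (σ y) (σ v) := fun g y v =>
    DFunLike.congr_fun (σ.toContinuousLinearEquiv.comp_right_fderiv (f := g) (x := y)) v
  refine Finset.sum_congr rfl fun i _ => ?_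
  obtain ⟨s, hs, hi⟩ := hσ i
  have h1 : (fun y => fderiv ℝ (fun y => f (σ y)) y (EuclideanSpace.single i 1)) =
      s • fun y => fderiv ℝ f (σ y) (EuclideanSpace.single i 1) := by
    ext y
    rw [hch f, hi, map_smul, Pi.smul_apply]
  rw [h1, fderiv_const_smul_field, Pi.smul_apply, smul_apply,
    hch (fun z => fderiv ℝ f z (EuclideanSpace.single i 1)), hi, map_smul, smul_smul, hs, one_smul]

lemma IsSuperharmonic.comp_isometry (hw : IsSuperharmonic d w)
    (σ : EuclideanSpace ℝ (Fin d) ≃ₗᵢ[ℝ] EuclideanSpace ℝ (Fin d)) (hσσ : ∀ x, σ (σ x) = x)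
    (hσ : ∀ i, ∃ s : ℝ, s * s = 1 ∧
      σ (EuclideanSpace.single i 1) = s • EuclideanSpace.single i 1) :
    IsSuperharmonic d fun x => w (σ x) := by
  refine ⟨hw.continuous.comp σ.continuous, fun c r hr g hgc hg hl hs x hx => ?_⟩
  have hdist : ∀ y, dist (σ y) c = dist y (σ c) := fun y => by
    rw [← σ.dist_map, hσσ]
  have := hw.le_of_le_on_sphere (σ c) r hr (fun y => g (σ y))
    (hgc.comp σ.continuous.continuousOn fun y hy => by
      rw [mem_closedBall, hdist]; exact hy)
    (fun y hy => ContDiffAt.comp y (g := g) (hg _ (by rw [mem_ball, hdist]; exact hy))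
      σ.contDiff.contDiffAt)
    (fun y hy => by
      rw [lapl_comp_isometry σ hσ]; exact hl _ (by rw [mem_ball, hdist]; exact hy))
    (fun y hy => by
      simpa [hσσ] using hs (σ y) (by rw [mem_sphere, hdist]; exact hy))
    (σ x) (by rw [mem_closedBall, ← hdist, hσσ]; exact hx)
  simpa [hσσ] using this

variable [NeZero d]

lemma isSuperharmonic_of_lapl_nonpos (hw : ContDiff ℝ 2 w) (hl : ∀ x, lapl d w x ≤ 0) :
    IsSuperharmonic d w :=
  ⟨hw.continuous, fun _ _ hr _ hgc hg hgl hs => le_on_closedBall_of_lapl_le hr hgc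
    hw.continuous.continuousOn hg (fun _ _ => hw.contDiffAt)
    (fun x hx => (hl x).trans (hgl x hx)) hs⟩

lemma IsSuperharmonic.lapl_nonpos_of_touching (hw : IsSuperharmonic d w)
    {Ψ : EuclideanSpace ℝ (Fin d) → ℝ} {x : EuclideanSpace ℝ (Fin d)} (hΨ : ContDiffAt ℝ 2 Ψ x)
    (hle : ∀ᶠ y in nhds x, Ψ y ≤ w y) (hx : Ψ x = w x) : lapl d Ψ x ≤ 0 := by
  by_contra! hpos
  have hd : (0 : ℝ) < d := by exact_mod_cast NeZero.pos d
  obtain ⟨ρ, hρ, hsub⟩ := Metric.mem_nhds_iff.1 (inter_mem (inter_mem hle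
    (hΨ.eventually (by simp)))
    ((continuousAt_lapl hΨ).eventually (lt_mem_nhds (half_lt_self hpos))))
  set s := ρ / 2
  have hs : 0 < s := by positivity
  have hsub' : closedBall x s ⊆ ball x ρ := closedBall_subset_ball (by simp only [s]; linarith)
  set η := lapl d Ψ x / (4 * d)
  have hη : 0 < η := by positivity
  have hc2 : ∀ y ∈ closedBall x s, ContDiffAt ℝ 2 Ψ y := fun y hy => (hsub (hsub' hy)).1.2
  have hq : ∀ y : EuclideanSpace ℝ (Fin d),
      ContDiffAt ℝ 2 (fun y => η * ‖y - x‖ ^ 2 - η * s ^ 2) y := fun y =>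
    (contDiffAt_const.mul (contDiff_sq_dist x).contDiffAt).sub contDiffAt_const
  have h1 := hw.le_of_le_on_sphere x s hs (fun y => Ψ y - (η * ‖y - x‖ ^ 2 - η * s ^ 2))
    (fun y hy => ((hc2 y hy).sub (hq y)).continuousAt.continuousWithinAt)
    (fun y hy => (hc2 y (ball_subset_closedBall hy)).sub (hq y))
    (fun y hy => by
      have hy' := ball_subset_closedBall hy
      rw [lapl_sub (hc2 y hy') (hq y),
        lapl_sub (contDiffAt_const.mul (contDiff_sq_dist x).contDiffAt) contDiffAt_const,
        lapl_const_mul _ (contDiff_sq_dist x).contDiffAt, lapl_sq_dist, lapl_const]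
      have h2 := (hsub (hsub' hy')).2
      have h3 : η * (2 * d) = lapl d Ψ x / 2 := by simp only [η]; field_simp; ring
      rw [mem_ofPred_eq] at h2
      linarith)
    (fun y hy => by
      have h2 := (hsub (hsub' (sphere_subset_closedBall hy))).1.1
      rw [mem_sphere, dist_eq_norm] at hy
      rw [mem_ofPred_eq] at h2
      rw [hy]
      linarith) x (mem_closedBall_self hs.le)
  have h3 : 0 < η * s ^ 2 := by positivity
  simp only [sub_self, norm_zero] at h1
  nlinarith

theorem IsSuperharmonic.superMeanVal (hw : IsSuperharmonic d w) : SuperMeanVal d w := by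
  refine superMeanVal_of_sphInt_le hw.continuous fun x r hr => ?_
  set S := (sphMeas d).real univ
  have hS : 0 < S := sphMeas_real_univ_pos
  refine le_of_forall_pos_le_add fun ε hε => ?_
  set η := ε / (2 * S)
  have hη : 0 < η := by positivity
  obtain ⟨H, hH, hHw⟩ := exists_harmonic_polynomial_near (c := x) hr hw.continuous hη
  have h1 : pev H x - η ≤ w x := hw.le_of_le_on_sphere x r hr (fun y => pev H y - η)
    ((continuous_pev H).sub continuous_const).continuousOn
    (fun y _ => (contDiff_pev H).contDiffAt.sub contDiffAt_const)
    (fun y _ => by rw [lapl_sub (contDiff_pev H).contDiffAt contDiffAt_const, lapl_const,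
      lapl_pev_of_harmonic hH, sub_zero])
    (fun y hy => by linarith [(abs_lt.1 (hHw y hy)).2]) x (mem_closedBall_self hr.le)
  have h2 : sphInt w x r ≤ sphInt (fun y => pev H y + η) x r := by
    refine integral_mono (integrable_sphMeas hw.continuous x r)
      (integrable_sphMeas ((continuous_pev H).add continuous_const) x r) fun θ => ?_
    have hθ : x + r • (θ : EuclideanSpace ℝ (Fin d)) ∈ sphere x r := by
      rw [mem_sphere, dist_eq_norm, add_sub_cancel_left, norm_smul, norm_eq_of_mem_sphere, mul_one,
        Real.norm_of_nonneg hr.le]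
    have := abs_lt.1 (hHw _ hθ)
    simp only
    linarith
  have h3 : sphInt (fun y => pev H y + η) x r = S * pev H x + S * η := by
    rw [← sphInt_pev_of_harmonic hH x hr.le]
    unfold sphInt
    rw [integral_add (integrable_sphMeas (continuous_pev H) x r) (integrable_const _),
      integral_const, smul_eq_mul]
  have h4 : 2 * (S * η) = ε := by simp only [η]; field_simp
  nlinarith

end SuperharmonicFunctions

section LeastSuperharmonicMajorant

variable {d : ℕ} {ψ : EuclideanSpace ℝ (Fin d) → ℝ}

/-- The least superharmonic function above a compactly supported obstacle exists. -/
theorem exists_least_superharmonic (hψ : Continuous ψ) (hc : HasCompactSupport ψ)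
    (hne : ∃ w, IsSuperharmonic d w ∧ ∀ x, ψ x ≤ w x) :
    ∃ v, IsSuperharmonic d v ∧ (∀ x, ψ x ≤ v x) ∧
      ∀ w, IsSuperharmonic d w → (∀ x, ψ x ≤ w x) → ∀ x, v x ≤ w x := by
  let 𝒮 : Type := {w : EuclideanSpace ℝ (Fin d) → ℝ // IsSuperharmonic d w ∧ ∀ x, ψ x ≤ w x}
  have : Nonempty 𝒮 := ⟨⟨hne.choose, hne.choose_spec⟩⟩
  set v : EuclideanSpace ℝ (Fin d) → ℝ := fun x => ⨅ w : 𝒮, w.1 x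
  have hbdd : ∀ x, BddBelow (range fun w : 𝒮 => w.1 x) := fun x =>
    ⟨ψ x, by rintro _ ⟨w, rfl⟩; exact w.2.2 x⟩
  have hv : ∀ w, IsSuperharmonic d w → (∀ x, ψ x ≤ w x) → ∀ x, v x ≤ w x := fun w h h' x =>
    ciInf_le (hbdd x) (⟨w, h, h'⟩ : 𝒮)
  have hunif : UniformContinuous ψ := hc.uniformContinuous_of_continuous hψ
  have hcont : Continuous v := by
    rw [Metric.continuous_iff]
    intro x ε hε
    obtain ⟨δ, hδ, hd⟩ := Metric.uniformContinuous_iff.1 hunif (ε / 2) (by positivity)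
    have key : ∀ y z, dist y z < δ → v y ≤ v z + ε / 2 := by
      intro y z hyz
      rw [← sub_le_iff_le_add]
      refine le_ciInf fun w => ?_
      have hshift : ∀ a, v a ≤ w.1 (a + (z - y)) + ε / 2 := by
        refine hv _ ((w.2.1.comp_add_right (z - y)).add_const _) fun a => ?_
        have h1 := hd (a := a) (b := a + (z - y)) (by
          rwa [dist_eq_norm, sub_add_cancel_left, neg_sub, ← dist_eq_norm])
        rw [Real.dist_eq, abs_lt] at h1
        linarith [w.2.2 (a + (z - y))]
      have := hshift y
      rw [add_sub_cancel] at this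
      linarith
    refine ⟨δ, hδ, fun y hy => ?_⟩
    have h1 := key y x hy
    have h2 := key x y (by rwa [dist_comm])
    rw [Real.dist_eq, abs_lt]
    constructor <;> linarith
  refine ⟨v, ⟨hcont, fun c r hr g hgc hg hl hs x hx => le_ciInf fun w => ?_⟩,
    fun x => le_ciInf fun w => w.2.2 x, hv⟩
  exact w.2.1.le_of_le_on_sphere c r hr g hgc hg hl
    (fun y hy => (hs y hy).trans (hv _ w.2.1 w.2.2 y)) x hx

/-- The least nonnegative superharmonic majorant is harmonic where it lies strictly above the
obstacle. -/
theorem harmonic_of_least_superharmonic [NeZero d] {v : EuclideanSpace ℝ (Fin d) → ℝ}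
    (hψ : Continuous ψ) (hv : IsSuperharmonic d v) (hψv : ∀ x, max (ψ x) 0 ≤ v x)
    (hleast : ∀ w, IsSuperharmonic d w → (∀ x, max (ψ x) 0 ≤ w x) → ∀ x, v x ≤ w x)
    {x : EuclideanSpace ℝ (Fin d)} (hx : ψ x < v x) : ContDiffAt ℝ 2 v x ∧ lapl d v x = 0 := by
  obtain ⟨μ, hμ1, hμ2⟩ := exists_between hx
  obtain ⟨ρ, hρ, hsub⟩ := Metric.mem_nhds_iff.1 (inter_mem
    (hψ.continuousAt.eventually (gt_mem_nhds hμ1))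
    (hv.continuous.continuousAt.eventually (lt_mem_nhds hμ2)))
  set s := ρ / 2
  have hs : 0 < s := by positivity
  have hsub' : closedBall x s ⊆ ball x ρ := closedBall_subset_ball (by simp only [s]; linarith)
  obtain ⟨h, hh, hhv⟩ := exists_isHarmonicLimit_eq_on_sphere x hs hv.continuous
  have hh2 : ∀ y ∈ ball x s, ContDiffAt ℝ 2 h y := fun y hy => hh.contDiffAt hy
  have hh0 : ∀ y ∈ ball x s, lapl d h y = 0 := fun y hy => hh.lapl_eq_zero hy
  have hμh : ∀ y ∈ closedBall x s, μ ≤ h y := by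
    refine le_on_closedBall_of_lapl_le (f := fun _ => μ) hs continuousOn_const hh.continuousOn
      (fun _ _ => contDiffAt_const) hh2 (fun y hy => by rw [hh0 y hy, lapl_const]) fun y hy => ?_
    rw [hhv y hy]
    exact le_of_lt (hsub (hsub' (sphere_subset_closedBall hy))).2
  have h0h : ∀ y ∈ closedBall x s, 0 ≤ h y := by
    refine le_on_closedBall_of_lapl_le (f := fun _ => 0) hs continuousOn_const hh.continuousOn
      (fun _ _ => contDiffAt_const) hh2 (fun y hy => by rw [hh0 y hy, lapl_const]) fun y hy => ?_
    rw [hhv y hy]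
    exact (le_max_right _ _).trans (hψv y)
  have hle : ∀ y ∈ closedBall x s, h y ≤ v y :=
    hv.le_of_le_on_sphere x s hs h hh.continuousOn hh2 (fun y hy => (hh0 y hy).ge)
      fun y hy => (hhv y hy).le
  classical
  set w := (closedBall x s).piecewise h v
  have hw1 : ∀ y ∈ closedBall x s, w y = h y := fun y hy => piecewise_eq_of_mem _ _ _ hy
  have hw2 : ∀ y, y ∉ ball x s → w y = v y := by
    intro y hy
    by_cases hy' : y ∈ closedBall x s
    · rw [hw1 y hy', hhv y]
      rw [mem_ball, not_lt] at hy
      exact le_antisymm hy' hy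
    · exact piecewise_eq_of_notMem _ _ _ hy'
  have hwv : ∀ y, w y ≤ v y := by
    intro y
    by_cases hy : y ∈ closedBall x s
    · rw [hw1 y hy]; exact hle y hy
    · exact (hw2 y fun h => hy (ball_subset_closedBall h)).le
  have hwc : Continuous w := by
    refine continuous_piecewise (fun y hy => ?_) ?_ hv.continuous.continuousOn
    · rw [frontier_closedBall x hs.ne'] at hy
      exact hhv y hy
    · rw [isClosed_closedBall.closure_eq]
      exact hh.continuousOn
  have hw : IsSuperharmonic d w := by
    refine ⟨hwc, fun c r hr g hgc hg hl hgs => ?_⟩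
    have hgv := hv.le_of_le_on_sphere c r hr g hgc hg hl fun y hy => (hgs y hy).trans (hwv y)
    have hU : IsOpen (ball c r ∩ ball x s) := isOpen_ball.inter isOpen_ball
    have hcl : ∀ y ∈ closure (ball c r ∩ ball x s), y ∈ closedBall c r ∧ y ∈ closedBall x s :=
      fun y hy => ⟨closure_ball_subset_closedBall (closure_mono inter_subset_left hy),
        closure_ball_subset_closedBall (closure_mono inter_subset_right hy)⟩
    have hcomp := le_zero_of_lapl_nonneg (f := fun y => g y - h y) hU
      (isBounded_ball.subset inter_subset_left)
      ((hgc.mono fun y hy => (hcl y hy).1).sub (hh.continuousOn.mono fun y hy => (hcl y hy).2))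
      (fun y hy => (hg y hy.1).sub (hh2 y hy.2))
      (fun y hy => by
        rw [lapl_sub (hg y hy.1) (hh2 y hy.2), hh0 y hy.2, sub_zero]; exact hl y hy.1)
      (fun y hy => by
        rw [hU.frontier_eq] at hy
        obtain ⟨h1, h2⟩ := hcl y hy.1
        by_cases hyc : y ∈ ball c r
        · have hyx : y ∉ ball x s := fun h => hy.2 ⟨hyc, h⟩
          have := hgv y h1
          rw [← hw2 y hyx, hw1 y h2] at this
          linarith
        · rw [mem_ball, not_lt] at hyc
          have := hgs y (le_antisymm h1 hyc)
          rw [hw1 y h2] at this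
          linarith)
    intro y hy
    by_cases hyx : y ∈ ball x s
    · by_cases hyc : y ∈ ball c r
      · rw [hw1 y (ball_subset_closedBall hyx)]
        linarith [hcomp y (subset_closure ⟨hyc, hyx⟩)]
      · rw [mem_ball, not_lt] at hyc
        exact hgs y (le_antisymm hy hyc)
    · rw [hw2 y hyx]
      exact hgv y hy
  have hψw : ∀ y, max (ψ y) 0 ≤ w y := by
    intro y
    by_cases hy : y ∈ closedBall x s
    · rw [hw1 y hy]
      exact max_le ((le_of_lt (hsub (hsub' hy)).1).trans (hμh y hy)) (h0h y hy)
    · rw [hw2 y fun h => hy (ball_subset_closedBall h)]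
      exact hψv y
  have heq : v =ᶠ[nhds x] h := by
    filter_upwards [closedBall_mem_nhds x hs] with y hy
    refine le_antisymm ?_ (hle y hy)
    rw [← hw1 y hy]
    exact hleast w hw hψw y
  exact ⟨(hh2 x (mem_ball_self hs)).congr_of_eventuallyEq heq,
    by rw [lapl_congr_nhds heq, hh0 x (mem_ball_self hs)]⟩

end LeastSuperharmonicMajorant

section HarmonicExtension

variable {n : ℕ}

lemma pev_rename_castSucc (q : MvPolynomial (Fin n) ℝ) (x : EuclideanSpace ℝ (Fin (n + 1))) :
    pev (MvPolynomial.rename Fin.castSucc q) x = pev q (thinProj n x) := by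
  simp only [pev, MvPolynomial.eval_rename]
  rfl

lemma pderiv_last_rename_castSucc (q : MvPolynomial (Fin n) ℝ) :
    MvPolynomial.pderiv (Fin.last n) (MvPolynomial.rename Fin.castSucc q) = 0 := by
  refine MvPolynomial.pderiv_eq_zero_of_notMem_vars fun h => ?_
  obtain ⟨i, -, hi⟩ := Finset.mem_image.1 (MvPolynomial.vars_rename _ _ h)
  exact (Fin.castSucc_lt_last i).ne hi

lemma polyLapl_rename_castSucc (q : MvPolynomial (Fin n) ℝ) :
    polyLapl (n + 1) (MvPolynomial.rename Fin.castSucc q) =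
      MvPolynomial.rename Fin.castSucc (polyLapl n q) := by
  simp [polyLapl_apply, Fin.sum_univ_castSucc, pderiv_last_rename_castSucc,
    MvPolynomial.pderiv_rename (Fin.castSucc_injective n)]

lemma polyLapl_X_pow_mul_rename (k : ℕ) (q : MvPolynomial (Fin n) ℝ) :
    polyLapl (n + 1) (MvPolynomial.X (Fin.last n) ^ (k + 2) *
        MvPolynomial.rename Fin.castSucc q) =
      MvPolynomial.C (((k + 2) * (k + 1) : ℕ) : ℝ) * MvPolynomial.X (Fin.last n) ^ k *
          MvPolynomial.rename Fin.castSucc q +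
        MvPolynomial.X (Fin.last n) ^ (k + 2) *
          MvPolynomial.rename Fin.castSucc (polyLapl n q) := by
  have h : ∀ i : Fin n, MvPolynomial.pderiv i.castSucc
      (MvPolynomial.X (Fin.last n) : MvPolynomial (Fin (n + 1)) ℝ) = 0 := fun i =>
    MvPolynomial.pderiv_X_of_ne (Fin.castSucc_lt_last i).ne'
  have h1 : k + 2 - 1 = k + 1 := rfl
  have h2 : k + 1 - 1 = k := rfl
  simp only [polyLapl_apply, Fin.sum_univ_castSucc, Derivation.leibniz, Derivation.leibniz_pow, h,
    pderiv_last_rename_castSucc, MvPolynomial.pderiv_rename (Fin.castSucc_injective n),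
    MvPolynomial.pderiv_X_self, map_sum, map_add, map_zero, smul_eq_mul, mul_one, nsmul_eq_mul,
    Derivation.map_natCast, Derivation.map_one_eq_zero, map_natCast, mul_zero, add_zero, zero_add,
    h1, h2, Finset.mul_sum]
  push_cast
  ring_nf

/-- The harmonic polynomial on `ℝ^{n+1}`, even in the last variable, that restricts to `q` on the
thin space. -/
def harmonicExtension (q : MvPolynomial (Fin n) ℝ) : MvPolynomial (Fin (n + 1)) ℝ :=
  ∑ k ∈ Finset.range (q.totalDegree / 2 + 1),
    MvPolynomial.C ((-1) ^ k / (Nat.factorial (2 * k) : ℝ)) *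
      (MvPolynomial.X (Fin.last n) ^ (2 * k) *
        MvPolynomial.rename Fin.castSucc ((polyLapl n ^ k) q))

lemma pev_harmonicExtension (q : MvPolynomial (Fin n) ℝ) (x : EuclideanSpace ℝ (Fin (n + 1))) :
    pev (harmonicExtension q) x = ∑ k ∈ Finset.range (q.totalDegree / 2 + 1),
      (-1) ^ k / (Nat.factorial (2 * k) : ℝ) *
        (x (Fin.last n) ^ (2 * k) * pev ((polyLapl n ^ k) q) (thinProj n x)) := by
  simp_rw [← pev_rename_castSucc]
  simp [harmonicExtension, pev]

lemma pev_harmonicExtension_of_last_eq_zero (q : MvPolynomial (Fin n) ℝ)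
    {x : EuclideanSpace ℝ (Fin (n + 1))} (hx : x (Fin.last n) = 0) :
    pev (harmonicExtension q) x = pev q (thinProj n x) := by
  rw [pev_harmonicExtension, Finset.sum_range_succ', Finset.sum_eq_zero] <;> simp [hx]

lemma totalDegree_polyLapl_pow_le (k : ℕ) (q : MvPolynomial (Fin n) ℝ) :
    ((polyLapl n ^ k) q).totalDegree ≤ q.totalDegree - 2 * k := by
  induction k with
  | zero => simp
  | succ k ih =>
    rw [pow_succ', Module.End.mul_apply]
    have := totalDegree_polyLapl_le ((polyLapl n ^ k) q)
    omega

lemma totalDegree_harmonicExtension_le (q : MvPolynomial (Fin n) ℝ) :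
    (harmonicExtension q).totalDegree ≤ q.totalDegree := by
  refine MvPolynomial.totalDegree_finsetSum_le fun k hk => ?_
  have hk' := Finset.mem_range.1 hk
  have h1 := totalDegree_polyLapl_pow_le k q
  have h2 := MvPolynomial.totalDegree_rename_le Fin.castSucc ((polyLapl n ^ k) q)
  have h3 := MvPolynomial.totalDegree_mul (MvPolynomial.X (Fin.last n) ^ (2 * k))
    (MvPolynomial.rename Fin.castSucc ((polyLapl n ^ k) q))
  rw [MvPolynomial.totalDegree_X_pow] at h3
  refine (MvPolynomial.totalDegree_mul _ _).trans ?_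
  rw [MvPolynomial.totalDegree_C]
  omega

lemma polyLapl_eq_zero_of_totalDegree_le_one {q : MvPolynomial (Fin n) ℝ}
    (hq : q.totalDegree ≤ 1) : polyLapl n q = 0 := by
  rw [polyLapl_apply]
  refine Finset.sum_eq_zero fun i _ => ?_
  have h := totalDegree_pderiv_le i q
  have h0 : (MvPolynomial.pderiv i q).totalDegree = 0 := by omega
  rw [MvPolynomial.totalDegree_eq_zero_iff_eq_C.1 h0, MvPolynomial.pderiv_C]

lemma polyLapl_harmonicExtension (q : MvPolynomial (Fin n) ℝ) :
    polyLapl (n + 1) (harmonicExtension q) = 0 := by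
  have key : ∀ N : ℕ, polyLapl (n + 1) (∑ k ∈ Finset.range (N + 1),
      MvPolynomial.C ((-1) ^ k / (Nat.factorial (2 * k) : ℝ)) *
        (MvPolynomial.X (Fin.last n) ^ (2 * k) *
          MvPolynomial.rename Fin.castSucc ((polyLapl n ^ k) q))) =
      MvPolynomial.C ((-1) ^ N / (Nat.factorial (2 * N) : ℝ)) *
        (MvPolynomial.X (Fin.last n) ^ (2 * N) *
          MvPolynomial.rename Fin.castSucc ((polyLapl n ^ (N + 1)) q)) := by
    intro N
    induction N with
    | zero => simp [polyLapl_rename_castSucc]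
    | succ N ih =>
      rw [Finset.sum_range_succ, map_add, ih, MvPolynomial.C_mul', MvPolynomial.C_mul',
        MvPolynomial.C_mul', map_smul, show 2 * (N + 1) = 2 * N + 2 from rfl,
        polyLapl_X_pow_mul_rename, ← Module.End.mul_apply, ← pow_succ', smul_add, mul_assoc,
        MvPolynomial.C_mul', smul_smul, ← add_assoc, ← add_smul]
      have h0 : ((-1 : ℝ) ^ N / (Nat.factorial (2 * N) : ℝ) + (-1) ^ (N + 1) /
          (Nat.factorial (2 * N + 2) : ℝ) * (((2 * N + 2) * (2 * N + 1) : ℕ) : ℝ)) = 0 := by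
        have := Nat.cast_ne_zero (R := ℝ).2 (Nat.factorial_ne_zero (2 * N))
        rw [Nat.factorial_succ, Nat.factorial_succ]
        push_cast
        field_simp
        ring
      rw [h0, zero_smul, zero_add]
  rw [harmonicExtension, key, pow_succ', Module.End.mul_apply,
    polyLapl_eq_zero_of_totalDegree_le_one, map_zero, mul_zero, mul_zero]
  have := totalDegree_polyLapl_pow_le (q.totalDegree / 2) q
  omega

end HarmonicExtension

section PolynomialGrowth

variable {d : ℕ}

lemma exists_abs_pev_le {p : MvPolynomial (Fin d) ℝ} {D : ℕ} (hp : p.totalDegree ≤ D) :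
    ∃ C, 0 ≤ C ∧ ∀ x, |pev p x| ≤ C * (1 + ‖x‖ ^ D) := by
  refine ⟨(∑ s ∈ p.support, |p.coeff s|) * 2 ^ (D - 1), by positivity, fun x => ?_⟩
  have h1 : (1 + ‖x‖) ^ D ≤ 2 ^ (D - 1) * (1 + ‖x‖ ^ D) := by
    simpa using add_pow_le zero_le_one (norm_nonneg x) D
  rw [pev, MvPolynomial.eval_eq', mul_assoc, Finset.sum_mul]
  refine (Finset.abs_sum_le_sum_abs _ _).trans (Finset.sum_le_sum fun s hs => ?_)
  rw [abs_mul]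
  refine mul_le_mul_of_nonneg_left (le_trans ?_ h1) (abs_nonneg _)
  have h2 : ∑ i, s i ≤ D := by
    have := (MvPolynomial.le_totalDegree hs).trans hp
    rwa [Finsupp.sum_fintype _ _ fun _ => rfl] at this
  have h3 : 1 ≤ 1 + ‖x‖ := by linarith [norm_nonneg x]
  calc |∏ i, x i ^ s i| = ∏ i, |x i| ^ s i := by simp [Finset.abs_prod]
    _ ≤ ∏ i, (1 + ‖x‖) ^ s i := by
        refine Finset.prod_le_prod (fun i _ => by positivity) fun i _ => ?_
        have h4 := PiLp.norm_apply_le x i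
        rw [Real.norm_eq_abs] at h4
        exact pow_le_pow_left₀ (abs_nonneg _) (by linarith) _
    _ = (1 + ‖x‖) ^ ∑ i, s i := Finset.prod_pow_eq_pow_sum _ _ _
    _ ≤ (1 + ‖x‖) ^ D := pow_le_pow_right₀ h3 h2

lemma pev_smul_of_isHomogeneous {p : MvPolynomial (Fin d) ℝ} {k : ℕ} (hp : p.IsHomogeneous k)
    (t : ℝ) (x : EuclideanSpace ℝ (Fin d)) : pev p (t • x) = t ^ k * pev p x := by
  simp only [pev, MvPolynomial.eval_eq', Finset.mul_sum]
  refine Finset.sum_congr rfl fun s hs => ?_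
  have h := hp (MvPolynomial.mem_support_iff.1 hs)
  rw [Finsupp.weight_apply, Finsupp.sum_fintype _ _ (by simp)] at h
  simp only [Pi.one_apply, smul_eq_mul, mul_one] at h
  simp only [PiLp.smul_apply, smul_eq_mul, mul_pow, Finset.prod_mul_distrib,
    Finset.prod_pow_eq_pow_sum, h]
  ring

lemma totalDegree_le_of_abs_pev_le {p : MvPolynomial (Fin d) ℝ} {k : ℕ} {C : ℝ}
    (h : ∀ x, |pev p x| ≤ C * (1 + ‖x‖ ^ k)) : p.totalDegree ≤ k := by
  by_contra! hk
  set D := p.totalDegree with hD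
  have hsum : ∀ (t : ℝ) x, pev p (t • x) =
      ∑ i ∈ Finset.range (D + 1), t ^ i * pev (MvPolynomial.homogeneousComponent i p) x := by
    intro t x
    conv_lhs => rw [← MvPolynomial.sum_homogeneousComponent p]
    rw [pev, map_sum]
    exact Finset.sum_congr rfl fun i _ =>
      pev_smul_of_isHomogeneous (MvPolynomial.homogeneousComponent_isHomogeneous i p) t x
  have hzero : ∀ x, pev (MvPolynomial.homogeneousComponent D p) x = 0 := by
    intro x
    have hlim : Tendsto (fun t : ℝ => pev p (t • x) / t ^ D) atTop
        (nhds (pev (MvPolynomial.homogeneousComponent D p) x)) := by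
      have h1 : Tendsto (fun t : ℝ => ∑ i ∈ Finset.range D,
          t ^ i / t ^ D * pev (MvPolynomial.homogeneousComponent i p) x +
            pev (MvPolynomial.homogeneousComponent D p) x) atTop
          (nhds (∑ i ∈ Finset.range D, 0 * pev (MvPolynomial.homogeneousComponent i p) x +
            pev (MvPolynomial.homogeneousComponent D p) x)) :=
        (tendsto_finsetSum _ fun i hi =>
          (tendsto_pow_div_pow_atTop_zero (Finset.mem_range.1 hi)).mul_const _).add_const _
      simp only [zero_mul, Finset.sum_const_zero, zero_add] at h1
      refine h1.congr' ?_
      filter_upwards [eventually_gt_atTop 0] with t ht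
      rw [hsum, Finset.sum_range_succ, add_div, Finset.sum_div,
        mul_div_cancel_left₀ _ (pow_pos ht D).ne']
      simp only [div_mul_eq_mul_div]
    have hlim0 : Tendsto (fun t : ℝ => pev p (t • x) / t ^ D) atTop (nhds 0) := by
      have h2 : Tendsto (fun t : ℝ => C * (t ^ 0 / t ^ D + t ^ k / t ^ D * ‖x‖ ^ k)) atTop
          (nhds (C * (0 + 0 * ‖x‖ ^ k))) :=
        ((tendsto_pow_div_pow_atTop_zero (by omega)).add
          ((tendsto_pow_div_pow_atTop_zero hk).mul_const _)).const_mul C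
      simp only [zero_mul, add_zero, mul_zero] at h2
      refine squeeze_zero_norm' ?_ h2
      filter_upwards [eventually_gt_atTop 0] with t ht
      rw [Real.norm_eq_abs, abs_div, abs_of_pos (pow_pos ht D), div_le_iff₀ (pow_pos ht D)]
      refine (h _).trans_eq ?_
      rw [norm_smul, Real.norm_eq_abs, abs_of_pos ht, mul_pow]
      field_simp
    exact tendsto_nhds_unique hlim hlim0
  have hcomp : MvPolynomial.homogeneousComponent D p = 0 :=
    eq_zero_of_pev_eq_zero_on_open isOpen_univ (mem_univ 0) fun x _ => hzero x
  have hpos : p.support.Nonempty := by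
    rw [Finset.nonempty_iff_ne_empty, Ne, MvPolynomial.support_eq_empty]
    rintro rfl
    simp at hD
    omega
  obtain ⟨s, hs, hsD⟩ := Finset.exists_mem_eq_sup p.support hpos fun s => s.sum fun _ e => e
  have h3 := MvPolynomial.coeff_homogeneousComponent D p s
  rw [hcomp, if_pos, MvPolynomial.coeff_zero] at h3
  · exact MvPolynomial.mem_support_iff.1 hs h3.symm
  · rw [hD, MvPolynomial.totalDegree, hsD]
    rfl

end PolynomialGrowth

section RadialBarrier

variable {d : ℕ}

lemma lapl_radial {φ φ₁ φ₂ : ℝ → ℝ} (h₁ : ∀ s, 0 ≤ s → HasDerivAt φ (φ₁ s) s)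
    (h₂ : ∀ s, 0 ≤ s → HasDerivAt φ₁ (φ₂ s) s) (c x : EuclideanSpace ℝ (Fin d)) :
    lapl d (fun y => φ (‖y - c‖ ^ 2)) x =
      4 * ‖x - c‖ ^ 2 * φ₂ (‖x - c‖ ^ 2) + 2 * d * φ₁ (‖x - c‖ ^ 2) := by
  have hsq : ∀ y, HasFDerivAt (fun y : EuclideanSpace ℝ (Fin d) => ‖y - c‖ ^ 2)
      (2 • innerSL ℝ (y - c)) y := fun y => by
    have := ((hasFDerivAt_id y).sub_const c).norm_sq
    simpa using this
  have hcoord : ∀ (i : Fin d) y, HasFDerivAt (fun y : EuclideanSpace ℝ (Fin d) => 2 * (y - c) i)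
      ((2 : ℝ) • (EuclideanSpace.proj i : EuclideanSpace ℝ (Fin d) →L[ℝ] ℝ)) y := fun i y => by
    have h := ((EuclideanSpace.proj i : EuclideanSpace ℝ (Fin d) →L[ℝ] ℝ).hasFDerivAt.comp y
      ((hasFDerivAt_id y).sub_const c)).const_mul 2
    exact h
  have hinner : ∀ (i : Fin d) (y : EuclideanSpace ℝ (Fin d)),
      inner ℝ y (EuclideanSpace.single i 1) = y i := fun i y => by
    simp [EuclideanSpace.inner_single_right]
  have hterm : ∀ i : Fin d, fderiv ℝ (fun y => fderiv ℝ (fun y => φ (‖y - c‖ ^ 2)) y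
      (EuclideanSpace.single i 1)) x (EuclideanSpace.single i 1) =
      4 * φ₂ (‖x - c‖ ^ 2) * (x - c) i ^ 2 + 2 * φ₁ (‖x - c‖ ^ 2) := by
    intro i
    have hfirst : (fun y => fderiv ℝ (fun y => φ (‖y - c‖ ^ 2)) y (EuclideanSpace.single i 1)) =
        fun y => φ₁ (‖y - c‖ ^ 2) * (2 * (y - c) i) := by
      funext y
      have h := (h₁ _ (sq_nonneg ‖y - c‖)).comp_hasFDerivAt y (hsq y)
      rw [HasFDerivAt.fderiv (f := fun y => φ (‖y - c‖ ^ 2)) h]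
      simp [hinner, -PiLp.sub_apply]
    have h := ((h₂ _ (sq_nonneg ‖x - c‖)).comp_hasFDerivAt x (hsq x)).mul (hcoord i x)
    rw [hfirst, HasFDerivAt.fderiv (f := fun y => φ₁ (‖y - c‖ ^ 2) * (2 * (y - c) i)) h]
    simp [hinner, -PiLp.sub_apply]
    ring
  rw [lapl, Finset.sum_congr rfl fun i _ => hterm i, Finset.sum_add_distrib, ← Finset.mul_sum,
    ← EuclideanSpace.real_norm_sq_eq]
  simp
  ring

variable [NeZero d]

lemma isSuperharmonic_rpow_neg_half (hd : 3 ≤ d) {b : ℝ} (hb : 0 ≤ b)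
    (c : EuclideanSpace ℝ (Fin d)) {A : ℝ} (hA : 0 ≤ A) :
    IsSuperharmonic d fun x => A * (1 + b * ‖x - c‖ ^ 2) ^ (-1 / 2 : ℝ) := by
  have hpos : ∀ s, 0 ≤ s → 0 < 1 + b * s := fun s hs => by positivity
  have hbase : ContDiff ℝ 2 fun x : EuclideanSpace ℝ (Fin d) => 1 + b * ‖x - c‖ ^ 2 :=
    contDiff_const.add (contDiff_const.mul (contDiff_sq_dist c))
  have hC : ContDiff ℝ 2 fun x : EuclideanSpace ℝ (Fin d) =>
      (1 + b * ‖x - c‖ ^ 2) ^ (-1 / 2 : ℝ) :=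
    hbase.rpow_const_of_ne fun x => (hpos _ (sq_nonneg _)).ne'
  have hder : ∀ e s : ℝ, 0 ≤ s →
      HasDerivAt (fun s => (1 + b * s) ^ e) (b * e * (1 + b * s) ^ (e - 1)) s := fun e s hs => by
    have h := (((hasDerivAt_id s).const_mul b).const_add 1).rpow_const (p := e)
      (Or.inl (hpos s hs).ne')
    simpa using h
  refine isSuperharmonic_of_lapl_nonpos (contDiff_const.mul hC) fun x => ?_
  rw [lapl_const_mul A hC.contDiffAt]
  refine mul_nonpos_of_nonneg_of_nonpos hA ?_
  rw [lapl_radial (φ := fun s => (1 + b * s) ^ (-1 / 2 : ℝ)) (hder _)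
    fun s hs => (hder (-1 / 2 - 1) s hs).const_mul _]
  set ρ := ‖x - c‖ ^ 2
  have hρ : 0 ≤ ρ := sq_nonneg _
  have hs := hpos ρ hρ
  have hd' : (3 : ℝ) ≤ d := by exact_mod_cast hd
  have hsplit : (1 + b * ρ) ^ (-1 / 2 - 1 : ℝ) =
      (1 + b * ρ) ^ (-1 / 2 - 1 - 1 : ℝ) * (1 + b * ρ) := by
    rw [Real.rpow_sub_one hs.ne' (-1 / 2 - 1), div_mul_cancel₀ _ hs.ne']
  rw [hsplit]
  have hP : 0 ≤ b * (1 + b * ρ) ^ (-1 / 2 - 1 - 1 : ℝ) := by positivity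
  have hQ : 3 * (b * ρ) - d * (1 + b * ρ) ≤ 0 := by
    nlinarith [mul_nonneg hb hρ]
  linarith [mul_nonpos_of_nonneg_of_nonpos hP hQ]

/-- A bounded superharmonic function above a paraboloid, touching it at a given point. -/
lemma exists_barrier (hd : 3 ≤ d) {x₀ : EuclideanSpace ℝ (Fin d)} (hx₀ : ‖x₀‖ ≤ 1) {δ : ℝ}
    (hδ : 0 ≤ δ) : ∃ w, IsSuperharmonic d w ∧ (∀ x, 0 ≤ w x) ∧ (∃ C, ∀ x, w x ≤ C) ∧
      w x₀ = δ * (1 - ‖x₀‖ ^ 2 / 8) ∧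
      ∀ x, δ * (1 - ‖x‖ ^ 2 / 8 + ‖x - x₀‖ ^ 2 / 16) ≤ w x := by
  set a := ‖x₀‖ ^ 2 with ha
  have ha1 : a ≤ 1 := pow_le_one₀ (norm_nonneg _) hx₀
  have ha0 : 0 ≤ a := sq_nonneg _
  set b := 1 / (8 - 5 * a) with hb
  have hb0 : 0 < b := by rw [hb]; exact one_div_pos.2 (by linarith)
  set s₀ := 1 + b * (4 * a) with hs₀
  have hs₀pos : 0 < s₀ := by positivity
  have hs₀eq : s₀ = b * (8 - a) := by
    rw [hs₀, hb]
    have : 8 - 5 * a ≠ 0 := by linarith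
    field_simp
    ring
  have hA : 0 ≤ δ * (1 - a / 8) := mul_nonneg hδ (by linarith)
  have hdist : ‖x₀ - -x₀‖ ^ 2 = 4 * a := by
    rw [sub_neg_eq_add, ← two_smul ℝ x₀, norm_smul, mul_pow, ← ha]
    norm_num
  have hpos : ∀ x : EuclideanSpace ℝ (Fin d), 0 < 1 + b * ‖x - -x₀‖ ^ 2 := fun x => by positivity
  refine ⟨fun x => δ * (1 - a / 8) * s₀ ^ (1 / 2 : ℝ) *
    (1 + b * ‖x - -x₀‖ ^ 2) ^ (-1 / 2 : ℝ),
    isSuperharmonic_rpow_neg_half hd hb0.le (-x₀) (mul_nonneg hA (Real.rpow_nonneg hs₀pos.le _)),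
    fun x => mul_nonneg (mul_nonneg hA (Real.rpow_nonneg hs₀pos.le _))
      (Real.rpow_nonneg (hpos x).le _), ⟨δ * (1 - a / 8) * s₀ ^ (1 / 2 : ℝ) * 1, fun x => ?_⟩, ?_,
    fun x => ?_⟩
  · refine mul_le_mul_of_nonneg_left ?_ (mul_nonneg hA (Real.rpow_nonneg hs₀pos.le _))
    refine Real.rpow_le_one_of_one_le_of_nonpos ?_ (by norm_num)
    have : 0 ≤ b * ‖x - -x₀‖ ^ 2 := by positivity
    linarith
  · simp only [hdist, ← hs₀]
    rw [mul_assoc, ← Real.rpow_add hs₀pos]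
    norm_num
  · set s := 1 + b * ‖x - -x₀‖ ^ 2 with hs
    have hspos : 0 < s := hpos x
    set z := √(s / s₀) with hz
    have hz0 : 0 < z := Real.sqrt_pos.2 (by positivity)
    have hz2 : z ^ 2 = s / s₀ := Real.sq_sqrt (by positivity)
    have hzinv : s₀ ^ (1 / 2 : ℝ) * s ^ (-1 / 2 : ℝ) = 1 / z := by
      rw [hz, Real.sqrt_eq_rpow, Real.div_rpow hspos.le hs₀pos.le, neg_div,
        Real.rpow_neg hspos.le, one_div_div]
      rfl
    have htangent : 3 / 2 - z ^ 2 / 2 ≤ 1 / z := by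
      rw [le_div_iff₀ hz0]
      nlinarith [mul_nonneg (sq_nonneg (z - 1)) (by linarith : 0 ≤ z + 2)]
    have hpar : ‖x - -x₀‖ ^ 2 = 2 * ‖x‖ ^ 2 + 2 * a - ‖x - x₀‖ ^ 2 := by
      have := parallelogram_law_with_norm ℝ x x₀
      rw [sub_neg_eq_add]
      linarith
    have hval : (1 - a / 8) * (3 / 2 - z ^ 2 / 2) = 1 - ‖x‖ ^ 2 / 8 + ‖x - x₀‖ ^ 2 / 16 := by
      have h8 : 8 - a ≠ 0 := by linarith
      have h9 : s / s₀ = (1 / b + ‖x - -x₀‖ ^ 2) / (8 - a) := by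
        rw [hs₀eq, hs]
        field_simp
      rw [hz2, h9, hpar, hb, one_div_one_div]
      field_simp
      ring
    change _ ≤ δ * (1 - a / 8) * s₀ ^ (1 / 2 : ℝ) * s ^ (-1 / 2 : ℝ)
    rw [mul_assoc _ (s₀ ^ (1 / 2 : ℝ)), hzinv, ← hval, mul_assoc]
    refine mul_le_mul_of_nonneg_left ?_ hδ
    exact mul_le_mul_of_nonneg_left htangent (by linarith)

end RadialBarrier

section ThinCoordinates

variable {n : ℕ}

@[simp] lemma thinEmbed_last (x' : EuclideanSpace ℝ (Fin n)) (t : ℝ) :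
    thinEmbed n x' t (Fin.last n) = t := by
  simp [thinEmbed]

@[simp] lemma thinProj_thinEmbed (x' : EuclideanSpace ℝ (Fin n)) (t : ℝ) :
    thinProj n (thinEmbed n x' t) = x' := by
  ext i
  simp [thinEmbed, thinProj]

lemma thinEmbed_thinProj (x : EuclideanSpace ℝ (Fin (n + 1))) :
    thinEmbed n (thinProj n x) (x (Fin.last n)) = x := by
  ext i
  refine Fin.lastCases ?_ (fun i => ?_) i <;> simp [thinEmbed, thinProj]

lemma norm_sq_eq_thinProj (x : EuclideanSpace ℝ (Fin (n + 1))) :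
    ‖x‖ ^ 2 = ‖thinProj n x‖ ^ 2 + x (Fin.last n) ^ 2 := by
  simp [EuclideanSpace.norm_sq_eq, Fin.sum_univ_castSucc, thinProj]

lemma norm_thinProj_le (x : EuclideanSpace ℝ (Fin (n + 1))) : ‖thinProj n x‖ ≤ ‖x‖ :=
  le_of_sq_le_sq (by linarith [norm_sq_eq_thinProj x, sq_nonneg (x (Fin.last n))]) (norm_nonneg _)

lemma norm_thinEmbed_zero (x' : EuclideanSpace ℝ (Fin n)) : ‖thinEmbed n x' 0‖ = ‖x'‖ := by
  have h := norm_sq_eq_thinProj (thinEmbed n x' 0)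
  simp only [thinProj_thinEmbed, thinEmbed_last, ne_eq, OfNat.ofNat_ne_zero, not_false_eq_true,
    zero_pow, add_zero] at h
  exact (sq_eq_sq₀ (norm_nonneg _) (norm_nonneg _)).1 h

/-- The reflection `(x', t) ↦ (x', -t)`. -/
def reflectLast (n : ℕ) :
    EuclideanSpace ℝ (Fin (n + 1)) ≃ₗᵢ[ℝ] EuclideanSpace ℝ (Fin (n + 1)) :=
  LinearIsometryEquiv.piLpCongrRight 2 fun i =>
    if i = Fin.last n then LinearIsometryEquiv.neg ℝ else LinearIsometryEquiv.refl ℝ ℝ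

lemma reflectLast_apply (x : EuclideanSpace ℝ (Fin (n + 1))) (i : Fin (n + 1)) :
    reflectLast n x i = if i = Fin.last n then -x i else x i := by
  simp only [reflectLast, LinearIsometryEquiv.piLpCongrRight_apply]
  split_ifs with h <;> simp [h]

lemma reflectLast_thinEmbed (x' : EuclideanSpace ℝ (Fin n)) (t : ℝ) :
    reflectLast n (thinEmbed n x' t) = thinEmbed n x' (-t) := by
  ext i
  rw [reflectLast_apply]
  refine Fin.lastCases ?_ (fun i => ?_) i
  · simp
  · simp [thinEmbed, (Fin.castSucc_lt_last i).ne]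

lemma reflectLast_reflectLast (x : EuclideanSpace ℝ (Fin (n + 1))) :
    reflectLast n (reflectLast n x) = x := by
  rw [← thinEmbed_thinProj x, reflectLast_thinEmbed, reflectLast_thinEmbed, neg_neg]

lemma reflectLast_single (i : Fin (n + 1)) :
    ∃ s : ℝ, s * s = 1 ∧
      reflectLast n (EuclideanSpace.single i 1) = s • EuclideanSpace.single i 1 := by
  by_cases hi : i = Fin.last n
  · refine ⟨-1, by norm_num, ?_⟩
    ext j
    rw [reflectLast_apply]
    by_cases hj : j = Fin.last n <;> simp [hi, hj]
  · refine ⟨1, by norm_num, ?_⟩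
    ext j
    rw [reflectLast_apply]
    by_cases hj : j = Fin.last n
    · simp [hj, Ne.symm hi]
    · simp [hj]

lemma IsSuperharmonic.comp_reflectLast {w : EuclideanSpace ℝ (Fin (n + 1)) → ℝ}
    (hw : IsSuperharmonic (n + 1) w) :
    IsSuperharmonic (n + 1) fun x => w (reflectLast n x) :=
  hw.comp_isometry (reflectLast n) reflectLast_reflectLast reflectLast_single

lemma lapl_exp_mul_coord {d : ℕ} (a : ℝ) (i : Fin d) (x : EuclideanSpace ℝ (Fin d)) :
    lapl d (fun y => Real.exp (a * y i)) x = a ^ 2 * Real.exp (a * x i) := by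
  have h : ∀ y, HasFDerivAt (fun y : EuclideanSpace ℝ (Fin d) => Real.exp (a * y i))
      (Real.exp (a * y i) • a • (EuclideanSpace.proj i : EuclideanSpace ℝ (Fin d) →L[ℝ] ℝ)) y :=
    fun y => ((EuclideanSpace.proj i : EuclideanSpace ℝ (Fin d) →L[ℝ] ℝ).hasFDerivAt.const_mul
      a).exp
  have hterm : ∀ j : Fin d, fderiv ℝ (fun y => fderiv ℝ (fun y => Real.exp (a * y i)) y
      (EuclideanSpace.single j 1)) x (EuclideanSpace.single j 1) =
      if j = i then a ^ 2 * Real.exp (a * x i) else 0 := by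
    intro j
    have hfirst : (fun y => fderiv ℝ (fun y => Real.exp (a * y i)) y
        (EuclideanSpace.single j 1)) =
        fun y => (if j = i then a else 0) * Real.exp (a * y i) := by
      funext y
      rw [(h y).fderiv]
      by_cases hj : j = i
      · simp [hj, mul_comm]
      · simp [hj, Ne.symm hj]
    rw [hfirst, ((h x).const_mul _).fderiv]
    by_cases hj : j = i
    · simp [hj]
      ring
    · simp [hj]
  rw [lapl, Finset.sum_congr rfl fun j _ => hterm j]
  simp

end ThinCoordinates

section ObstacleProblem

variable {n : ℕ}

/-- An obstacle in `ℝ^{n+1}` that equals `-q` on the thin space and is strictly subharmonic off the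
thin space when `M` is large. -/
def steepObstacle (q : MvPolynomial (Fin n) ℝ) (M : ℝ) (x : EuclideanSpace ℝ (Fin (n + 1))) : ℝ :=
  Real.exp (-(M * |x (Fin.last n)|)) - 1 - pev (MvPolynomial.rename Fin.castSucc q) x

lemma continuous_steepObstacle (q : MvPolynomial (Fin n) ℝ) (M : ℝ) :
    Continuous (steepObstacle q M) := by
  have := continuous_pev (MvPolynomial.rename Fin.castSucc q)
  unfold steepObstacle
  fun_prop

lemma steepObstacle_reflectLast (q : MvPolynomial (Fin n) ℝ) (M : ℝ)
    (x : EuclideanSpace ℝ (Fin (n + 1))) :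
    steepObstacle q M (reflectLast n x) = steepObstacle q M x := by
  rw [← thinEmbed_thinProj x, reflectLast_thinEmbed]
  simp [steepObstacle, pev_rename_castSucc]

lemma lapl_steepObstacle (q : MvPolynomial (Fin n) ℝ) (M : ℝ)
    {x : EuclideanSpace ℝ (Fin (n + 1))} (hx : x (Fin.last n) ≠ 0) :
    ContDiffAt ℝ 2 (steepObstacle q M) x ∧ lapl (n + 1) (steepObstacle q M) x =
      M ^ 2 * Real.exp (-(M * |x (Fin.last n)|)) - pev (polyLapl n q) (thinProj n x) := by
  obtain ⟨a, ha, hloc⟩ : ∃ a : ℝ, a ^ 2 = M ^ 2 ∧ ∀ᶠ y in nhds x,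
      -(M * |y (Fin.last n)|) = a * y (Fin.last n) := by
    have hc : ContinuousAt (fun y : EuclideanSpace ℝ (Fin (n + 1)) => y (Fin.last n)) x := by
      fun_prop
    rcases lt_or_gt_of_ne hx with h | h
    · refine ⟨M, rfl, ?_⟩
      filter_upwards [hc.eventually (gt_mem_nhds h)] with y hy
      rw [abs_of_neg hy]
      ring
    · refine ⟨-M, by ring, ?_⟩
      filter_upwards [hc.eventually (lt_mem_nhds h)] with y hy
      rw [abs_of_pos hy]
      ring
  have heq : steepObstacle q M =ᶠ[nhds x] fun y => Real.exp (a * y (Fin.last n)) - 1 -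
      pev (MvPolynomial.rename Fin.castSucc q) y := by
    filter_upwards [hloc] with y hy
    rw [steepObstacle, hy]
  have h1 : ContDiffAt ℝ 2 (fun y : EuclideanSpace ℝ (Fin (n + 1)) =>
      Real.exp (a * y (Fin.last n))) x := by fun_prop
  have h2 := h1.sub (contDiffAt_const (c := (1 : ℝ)))
  have h3 := (contDiff_pev (k := 2) (MvPolynomial.rename Fin.castSucc q)).contDiffAt (x := x)
  refine ⟨(h2.sub h3).congr_of_eventuallyEq heq, ?_⟩
  rw [lapl_congr_nhds heq, lapl_sub h2 h3, lapl_sub h1 contDiffAt_const, lapl_const,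
    lapl_exp_mul_coord, lapl_pev, polyLapl_rename_castSucc, pev_rename_castSucc, hloc.self_of_nhds,
    ha, sub_zero]

/-- The least nonnegative superharmonic function above a steep obstacle. -/
lemma exists_least_above_steepObstacle {q : MvPolynomial (Fin n) ℝ} {M r C : ℝ}
    (hsupp : ∀ x, 0 ≤ steepObstacle q M x → ‖x‖ ≤ r)
    (hsub : ∀ x, 0 ≤ steepObstacle q M x → pev (polyLapl n q) (thinProj n x) <
      M ^ 2 * Real.exp (-(M * |x (Fin.last n)|)))
    (hne : ∃ w, IsSuperharmonic (n + 1) w ∧ (∀ x, 0 ≤ w x) ∧ (∀ x, w x ≤ C) ∧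
      ∀ x, steepObstacle q M x ≤ w x) :
    ∃ v, IsSuperharmonic (n + 1) v ∧ (∀ x, 0 ≤ v x) ∧ (∀ x, v x ≤ C) ∧
      (∀ x, steepObstacle q M x ≤ v x) ∧ (∀ x, v (reflectLast n x) = v x) ∧
      (∀ w, IsSuperharmonic (n + 1) w → (∀ x, 0 ≤ w x) → (∀ x, steepObstacle q M x ≤ w x) →
        ∀ x, v x ≤ w x) ∧
      ∀ x, (x (Fin.last n) = 0 → steepObstacle q M x < v x) →
        ContDiffAt ℝ 2 v x ∧ lapl (n + 1) v x = 0 := by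
  set Ψ := steepObstacle q M with hΨ
  have hΨc : Continuous Ψ := continuous_steepObstacle q M
  obtain ⟨w₀, hw₀, hw₀0, hw₀C, hw₀Ψ⟩ := hne
  have hcs : HasCompactSupport fun x => max (Ψ x) 0 := by
    refine HasCompactSupport.intro (isCompact_closedBall 0 r) fun x hx => max_eq_right ?_
    by_contra! h
    exact hx (mem_closedBall_zero_iff.2 (hsupp x h.le))
  obtain ⟨v, hv, hvΨ, hvmin⟩ := exists_least_superharmonic (hΨc.max continuous_const) hcs
    ⟨w₀, hw₀, fun x => max_le (hw₀Ψ x) (hw₀0 x)⟩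
  have hv0 : ∀ x, 0 ≤ v x := fun x => (le_max_right _ _).trans (hvΨ x)
  have hvle : ∀ x, Ψ x ≤ v x := fun x => (le_max_left _ _).trans (hvΨ x)
  refine ⟨v, hv, hv0, fun x => (hvmin w₀ hw₀ (fun x => max_le (hw₀Ψ x) (hw₀0 x)) x).trans (hw₀C x),
    hvle, ?_, fun w hw h0 h => hvmin w hw fun x => max_le (h x) (h0 x), fun x hx => ?_⟩
  · have h1 : ∀ x, v x ≤ v (reflectLast n x) :=
      hvmin _ hv.comp_reflectLast fun x => by
        rw [hΨ, ← steepObstacle_reflectLast]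
        exact hvΨ _
    intro x
    refine le_antisymm ?_ (h1 x)
    have := h1 (reflectLast n x)
    rwa [reflectLast_reflectLast] at this
  · refine harmonic_of_least_superharmonic hΨc hv hvΨ hvmin ?_
    by_cases hx0 : x (Fin.last n) = 0
    · exact hx hx0
    refine lt_of_le_of_ne (hvle x) fun heq => ?_
    obtain ⟨hC, hl⟩ := lapl_steepObstacle q M hx0
    have h1 := hv.lapl_nonpos_of_touching hC (Eventually.of_forall hvle) heq
    have h2 := hsub x (by rw [heq]; exact hv0 x)
    linarith

/-- Adding the harmonic extension of `q` to an even superharmonic function produces a solution of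
the thin obstacle problem. -/
lemma isGlobalSolution_add_harmonicExtension {q : MvPolynomial (Fin n) ℝ}
    {v : EuclideanSpace ℝ (Fin (n + 1)) → ℝ} (hv : IsSuperharmonic (n + 1) v)
    (heven : ∀ x, v (reflectLast n x) = v x)
    (hthin : ∀ x', -pev q x' ≤ v (thinEmbed n x' 0))
    (hharm : ∀ x, (x (Fin.last n) = 0 → -pev q (thinProj n x) < v x) →
      ContDiffAt ℝ 2 v x ∧ lapl (n + 1) v x = 0) :
    IsGlobalSolution n (fun _ => 0) fun x => pev (harmonicExtension q) x + v x := by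
  have hsup : IsSuperharmonic (n + 1) fun x => pev (harmonicExtension q) x + v x :=
    hv.add_pev (polyLapl_harmonicExtension q)
  refine ⟨hsup.continuous, fun x' t => ?_, fun x' => ?_, ?_, hsup.superMeanVal⟩
  · simp only [← reflectLast_thinEmbed, heven]
    simp [reflectLast_thinEmbed, pev_harmonicExtension, pow_mul]
  · simp only
    rw [pev_harmonicExtension_of_last_eq_zero q (thinEmbed_last x' 0), thinProj_thinEmbed]
    linarith [hthin x']
  · have key : ∀ x ∈ (contactSet n (fun _ => 0)
        fun x => pev (harmonicExtension q) x + v x)ᶜ,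
        ContDiffAt ℝ 2 v x ∧ lapl (n + 1) v x = 0 := by
      intro x hx
      refine hharm x fun hx0 => lt_of_le_of_ne ?_ fun heq => hx ⟨hx0, ?_⟩
      · have := hthin (thinProj n x)
        rwa [← hx0, thinEmbed_thinProj] at this
      · simp only
        rw [pev_harmonicExtension_of_last_eq_zero q hx0, ← heq]
        ring
    refine ⟨fun x hx => ((contDiff_pev _).contDiffAt.add (key x hx).1).contDiffWithinAt,
      fun x hx => ?_⟩
    rw [lapl_add (contDiff_pev _).contDiffAt (key x hx).1, (key x hx).2, lapl_pev,
      polyLapl_harmonicExtension]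
    simp [pev]

end ObstacleProblem

section PerturbedObstacle

variable {n : ℕ} {q : MvPolynomial (Fin n) ℝ} {δ M : ℝ}

lemma exp_neg_mul_one_add_le {s t : ℝ} (hts : t ≤ s) :
    Real.exp (-s) * (1 + t) ≤ 1 := by
  rw [Real.exp_neg, inv_mul_le_one₀ (Real.exp_pos s)]
  linarith [Real.add_one_le_exp s]

lemma steepObstacle_le (hq : ∀ x', -pev q x' ≤ δ * (1 - ‖x'‖ ^ 2 / 8))
    (x : EuclideanSpace ℝ (Fin (n + 1))) : steepObstacle q M x ≤
      Real.exp (-(M * |x (Fin.last n)|)) - 1 + δ * (1 - ‖thinProj n x‖ ^ 2 / 8) := by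
  rw [steepObstacle, pev_rename_castSucc]
  linarith [hq (thinProj n x)]

lemma half_le_exp_of_steepObstacle_nonneg (hq : ∀ x', -pev q x' ≤ δ * (1 - ‖x'‖ ^ 2 / 8))
    (hδ : 0 < δ) (hδ2 : δ ≤ 1 / 2) {x : EuclideanSpace ℝ (Fin (n + 1))}
    (hx : 0 ≤ steepObstacle q M x) : 1 / 2 ≤ Real.exp (-(M * |x (Fin.last n)|)) := by
  have h1 := steepObstacle_le (M := M) hq x
  nlinarith [sq_nonneg ‖thinProj n x‖]

lemma norm_le_three_of_steepObstacle_nonneg (hq : ∀ x', -pev q x' ≤ δ * (1 - ‖x'‖ ^ 2 / 8))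
    (hδ : 0 < δ) (hδ2 : δ ≤ 1 / 2) (hM : 1 ≤ M) {x : EuclideanSpace ℝ (Fin (n + 1))}
    (hx : 0 ≤ steepObstacle q M x) : ‖x‖ ≤ 3 := by
  have h1 := steepObstacle_le (M := M) hq x
  have h2 := half_le_exp_of_steepObstacle_nonneg hq hδ hδ2 hx
  have h3 := exp_neg_mul_one_add_le (s := M * |x (Fin.last n)|)
    (le_mul_of_one_le_left (abs_nonneg _) hM)
  have h4 : |x (Fin.last n)| ≤ 1 := by
    nlinarith [abs_nonneg (x (Fin.last n))]
  have h5 : x (Fin.last n) ^ 2 ≤ 1 := (sq_le_one_iff_abs_le_one _).2 h4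
  have h6 : Real.exp (-(M * |x (Fin.last n)|)) ≤ 1 := Real.exp_le_one_iff.2 (by
    have : 0 ≤ M * |x (Fin.last n)| := by positivity
    linarith)
  have h7 : ‖thinProj n x‖ ^ 2 ≤ 8 := by
    by_contra! h
    nlinarith
  have h8 := norm_sq_eq_thinProj x
  nlinarith [norm_nonneg x]

lemma steepObstacle_le_barrier (hq : ∀ x', -pev q x' ≤ δ * (1 - ‖x'‖ ^ 2 / 8))
    (hδ : 0 < δ) (hδ2 : δ ≤ 1 / 2) (hM : 1 ≤ M) {x₀ : EuclideanSpace ℝ (Fin (n + 1))}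
    (hx₀ : x₀ (Fin.last n) = 0) {w : EuclideanSpace ℝ (Fin (n + 1)) → ℝ} (hw0 : ∀ x, 0 ≤ w x)
    (hw : ∀ x, δ * (1 - ‖x‖ ^ 2 / 8 + ‖x - x₀‖ ^ 2 / 16) ≤ w x)
    (x : EuclideanSpace ℝ (Fin (n + 1))) : steepObstacle q M x ≤ w x := by
  refine (steepObstacle_le hq x).trans ?_
  have h1 := exp_neg_mul_one_add_le (s := M * |x (Fin.last n)|)
    (le_mul_of_one_le_left (abs_nonneg _) hM)
  have h2 := Real.exp_pos (-(M * |x (Fin.last n)|))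
  rcases le_total |x (Fin.last n)| 1 with ht | ht
  · refine le_trans ?_ (hw x)
    have h3 : x (Fin.last n) ^ 2 ≤ ‖x - x₀‖ ^ 2 := by
      have := norm_sq_eq_thinProj (x - x₀)
      simp only [PiLp.sub_apply, hx₀, sub_zero] at this
      linarith [sq_nonneg ‖thinProj n (x - x₀)‖]
    have h4 : x (Fin.last n) ^ 2 / 2 ≤ 1 - Real.exp (-(M * |x (Fin.last n)|)) := by
      rw [← sq_abs]
      nlinarith [abs_nonneg (x (Fin.last n))]
    rw [norm_sq_eq_thinProj x]
    nlinarith [sq_nonneg (x (Fin.last n))]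
  · refine le_trans ?_ (hw0 x)
    nlinarith [sq_nonneg ‖thinProj n x‖]

/-- For a polynomial obstacle `-q` on the thin space lying below a paraboloid, there is an even
solution touching `-q` wherever `-q` touches the paraboloid in the unit ball. -/
lemma exists_solution_of_le_paraboloid (hn : 2 ≤ n)
    (hq : ∀ x', -pev q x' ≤ δ * (1 - ‖x'‖ ^ 2 / 8)) (hδ : 0 < δ) (hδ2 : δ ≤ 1 / 2) :
    ∃ (v : EuclideanSpace ℝ (Fin (n + 1)) → ℝ) (C : ℝ), (∀ x, 0 ≤ v x) ∧ (∀ x, v x ≤ C) ∧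
      IsGlobalSolution n (fun _ => 0) (fun x => pev (harmonicExtension q) x + v x) ∧
      ∀ x', ‖x'‖ ≤ 1 → -pev q x' = δ * (1 - ‖x'‖ ^ 2 / 8) →
        v (thinEmbed n x' 0) = -pev q x' := by
  obtain ⟨M₀, hM₀⟩ :=
    (isCompact_closedBall (0 : EuclideanSpace ℝ (Fin n)) 3).exists_bound_of_continuousOn
      (continuous_pev (polyLapl n q)).continuousOn
  have hM₀0 : 0 ≤ M₀ := (norm_nonneg _).trans (hM₀ 0 (by simp))
  have hM1 : 1 ≤ M₀ + 2 := by linarith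
  have hd : 3 ≤ n + 1 := by omega
  have hthin0 : ∀ x : EuclideanSpace ℝ (Fin (n + 1)), x (Fin.last n) = 0 →
      steepObstacle q (M₀ + 2) x = -pev q (thinProj n x) := fun x hx => by
    simp [steepObstacle, pev_rename_castSucc, hx]
  obtain ⟨w₀, hw₀, hw₀0, ⟨C, hC⟩, -, hw₀le⟩ :=
    exists_barrier hd (x₀ := 0) (by simp) hδ.le
  obtain ⟨v, hv, hv0, hvC, hvle, heven, hmin, hharm⟩ :=
    exists_least_above_steepObstacle (q := q) (M := M₀ + 2) (r := 3) (C := C)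
      (fun x hx => norm_le_three_of_steepObstacle_nonneg hq hδ hδ2 hM1 hx)
      (fun x hx => by
        have h1 := half_le_exp_of_steepObstacle_nonneg hq hδ hδ2 hx
        have h2 := hM₀ (thinProj n x) (mem_closedBall_zero_iff.2 ((norm_thinProj_le x).trans
          (norm_le_three_of_steepObstacle_nonneg hq hδ hδ2 hM1 hx)))
        have h3 := le_of_abs_le h2
        nlinarith)
      ⟨w₀, hw₀, hw₀0, hC, steepObstacle_le_barrier hq hδ hδ2 hM1 (by simp) hw₀0 hw₀le⟩
  refine ⟨v, C, hv0, hvC, isGlobalSolution_add_harmonicExtension hv heven (fun x' => ?_)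
    (fun x hx => hharm x fun hx0 => by rw [hthin0 x hx0]; exact hx hx0), fun x' hx' heq => ?_⟩
  · have := hvle (thinEmbed n x' 0)
    rwa [hthin0 _ (thinEmbed_last x' 0), thinProj_thinEmbed] at this
  · refine le_antisymm ?_ ?_
    · obtain ⟨w, hw, hw0, -, hwx, hwle⟩ := exists_barrier hd (x₀ := thinEmbed n x' 0)
        (by rwa [norm_thinEmbed_zero]) hδ.le
      refine (hmin w hw hw0 (steepObstacle_le_barrier hq hδ hδ2 hM1 (thinEmbed_last x' 0) hw0 hwle)
        _).trans_eq ?_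
      rw [hwx, norm_thinEmbed_zero, heq]
    · have := hvle (thinEmbed n x' 0)
      rwa [hthin0 _ (thinEmbed_last x' 0), thinProj_thinEmbed] at this

lemma exists_lt_pev_of_le_infDist {f : MvPolynomial (Fin n) ℝ} (hf : ∀ x', 0 ≤ pev f x') {ε : ℝ}
    (hε : 0 < ε) : ∃ δ, 0 < δ ∧ δ ≤ 1 / 2 ∧
      ∀ x', ‖x'‖ ≤ 3 → ε ≤ infDist x' {y' | pev f y' = 0} → δ < pev f x' := by
  set K := closedBall (0 : EuclideanSpace ℝ (Fin n)) 3 ∩ {x' | ε ≤ infDist x' {y' | pev f y' = 0}}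
    with hK
  have hKc : IsCompact K := (isCompact_closedBall _ _).inter_right
    (isClosed_le continuous_const (continuous_infDist_pt _))
  rcases K.eq_empty_or_nonempty with hKe | hKn
  · refine ⟨1 / 2, by norm_num, le_rfl, fun x' h1 h2 => ?_⟩
    have : x' ∈ K := ⟨mem_closedBall_zero_iff.2 h1, h2⟩
    simp [hKe] at this
  · obtain ⟨z, hz, hzmin⟩ := hKc.exists_isMinOn hKn (continuous_pev f).continuousOn
    have hfz : 0 < pev f z := by
      refine lt_of_le_of_ne (hf z) fun h => ?_
      have h0 : infDist z {y' | pev f y' = 0} = 0 := infDist_zero_of_mem h.symm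
      have h1 : ε ≤ infDist z {y' | pev f y' = 0} := hz.2
      linarith
    refine ⟨min (1 / 2) (pev f z / 2), by positivity, min_le_left _ _, fun x' h1 h2 => ?_⟩
    have h3 : pev f z ≤ pev f x' := hzmin (a := x') ⟨mem_closedBall_zero_iff.2 h1, h2⟩
    have h4 := min_le_right (1 / 2) (pev f z / 2)
    linarith

lemma polyGrowthOrder_add_harmonicExtension {f : MvPolynomial (Fin n) ℝ}
    {v : EuclideanSpace ℝ (Fin (n + 1)) → ℝ} {C : ℝ} (hf : ∀ x', 0 ≤ pev f x')
    (hfq : ∀ x', pev f x' ≤ pev q x' + δ) (hδ : 0 ≤ δ) (hqf : q.totalDegree ≤ f.totalDegree)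
    (hv : ∀ x, 0 ≤ v x) (hvC : ∀ x, v x ≤ C) :
    PolyGrowthOrder (n + 1) (fun x => pev (harmonicExtension q) x + v x) f.totalDegree := by
  constructor
  · obtain ⟨A, hA, hp⟩ := exists_abs_pev_le ((totalDegree_harmonicExtension_le q).trans hqf)
    refine ⟨A + C, fun x => (abs_add_le _ _).trans ?_⟩
    have hC : 0 ≤ C := (hv x).trans (hvC x)
    rw [abs_of_nonneg (hv x), add_mul]
    have h1 : 0 ≤ C * ‖x‖ ^ f.totalDegree := by positivity
    linarith [hp x, hvC x]
  · rintro k ⟨A, hA⟩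
    refine totalDegree_le_of_abs_pev_le (C := A + δ) fun x' => ?_
    have h1 := hA (thinEmbed n x' 0)
    simp only at h1
    rw [pev_harmonicExtension_of_last_eq_zero q (thinEmbed_last x' 0), thinProj_thinEmbed,
      norm_thinEmbed_zero] at h1
    have h2 : 0 ≤ δ * ‖x'‖ ^ k := by positivity
    rw [abs_of_nonneg (hf x'), add_mul]
    linarith [le_of_abs_le h1, hfq x', hv (thinEmbed n x' 0)]

end PerturbedObstacle

/-- there is `R > 1` depending only on `n` such that for any nonnegative
polynomial `f` on `ℝ^n` of degree `m ≥ 2` and any `ε > 0` there is a global solution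
with growth of order exactly `m` whose contact set contains `({f = 0} × {0}) ∩ B₁`
and is contained in an `ε`-neighborhood of `{f = 0}` intersected with `B_R`. -/
theorem statement10 (n : ℕ) (hn : 2 ≤ n) :
    ∃ R : ℝ, 1 < R ∧
      ∀ (f : MvPolynomial (Fin n) ℝ) (m : ℕ),
        (∀ x' : EuclideanSpace ℝ (Fin n), 0 ≤ pev f x') →
        f.totalDegree = m → 2 ≤ m →
        ∀ ε > 0, ∃ u : EuclideanSpace ℝ (Fin (n + 1)) → ℝ,
          IsGlobalSolution n (fun _ => 0) u ∧
          PolyGrowthOrder (n + 1) u m ∧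
          thinSet n {x' | pev f x' = 0} ∩ Metric.closedBall 0 1 ⊆
            contactSet n (fun _ => 0) u ∧
          contactSet n (fun _ => 0) u ⊆
            thinSet n {x' | Metric.infDist x' {y' : EuclideanSpace ℝ (Fin n) |
              pev f y' = 0} ≤ ε} ∩ Metric.closedBall 0 R := by
  refine ⟨3, by norm_num, ?_⟩
  rintro f m hf rfl hm ε hε
  obtain ⟨δ, hδ, hδ2, hδf⟩ := exists_lt_pev_of_le_infDist hf hε
  set q : MvPolynomial (Fin n) ℝ :=
    f - MvPolynomial.C δ * (1 - MvPolynomial.C (1 / 8) * sqDistPoly 0) with hq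
  have hqval : ∀ x', pev q x' = pev f x' - δ * (1 - ‖x'‖ ^ 2 / 8) := fun x' => by
    have h1 : pev (1 : MvPolynomial (Fin n) ℝ) x' = 1 := by simp [pev]
    rw [hq, pev_sub, pev_mul, pev_sub, pev_mul, pev_C, pev_C, pev_sqDistPoly, sub_zero, h1]
    ring
  have hqdeg : q.totalDegree ≤ f.totalDegree := by
    have h1 := MvPolynomial.totalDegree_mul (MvPolynomial.C (1 / 8))
      (sqDistPoly (0 : EuclideanSpace ℝ (Fin n)))
    have h2 := MvPolynomial.totalDegree_sub 1
      (MvPolynomial.C (1 / 8) * sqDistPoly (0 : EuclideanSpace ℝ (Fin n)))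
    have h3 := MvPolynomial.totalDegree_mul (MvPolynomial.C δ)
      (1 - MvPolynomial.C (1 / 8) * sqDistPoly (0 : EuclideanSpace ℝ (Fin n)))
    have h4 := totalDegree_sqDistPoly_le (0 : EuclideanSpace ℝ (Fin n))
    rw [MvPolynomial.totalDegree_C] at h1 h3
    rw [MvPolynomial.totalDegree_one] at h2
    refine (MvPolynomial.totalDegree_sub _ _).trans (max_le le_rfl ?_)
    omega
  have hqle : ∀ x', -pev q x' ≤ δ * (1 - ‖x'‖ ^ 2 / 8) := fun x' => by
    linarith [hqval x', hf x']
  obtain ⟨v, C, hv0, hvC, hsol, htouch⟩ := exists_solution_of_le_paraboloid hn hqle hδ hδ2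
  have hthin : ∀ x', pev (harmonicExtension q) (thinEmbed n x' 0) = pev q x' := fun x' => by
    rw [pev_harmonicExtension_of_last_eq_zero q (thinEmbed_last x' 0), thinProj_thinEmbed]
  refine ⟨_, hsol, polyGrowthOrder_add_harmonicExtension hf (δ := δ) (fun x' => ?_) hδ.le hqdeg
    hv0 hvC, ?_, ?_⟩
  · rw [hqval]
    have : 0 ≤ δ * (‖x'‖ ^ 2 / 8) := by positivity
    linarith
  · rintro _ ⟨⟨x', hx', rfl⟩, hball⟩
    replace hx' : pev f x' = 0 := hx'
    replace hball : ‖x'‖ ≤ 1 := by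
      simpa only [mem_closedBall_zero_iff, norm_thinEmbed_zero] using hball
    refine ⟨thinEmbed_last x' 0, ?_⟩
    simp only
    rw [hthin, htouch x' hball (by rw [hqval, hx']; ring)]
    ring
  · rintro x ⟨hx0, hx⟩
    obtain ⟨x', rfl⟩ : ∃ x', thinEmbed n x' 0 = x :=
      ⟨thinProj n x, by rw [← hx0, thinEmbed_thinProj]⟩
    simp only [hthin, hqval] at hx
    have h1 := hv0 (thinEmbed n x' 0)
    have h2 : ‖x'‖ ^ 2 ≤ 8 := by
      by_contra! h
      nlinarith [hf x']
    have h3 : ‖x'‖ ≤ 3 := by nlinarith [norm_nonneg x']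
    refine ⟨⟨x', ?_, rfl⟩, by rwa [mem_closedBall_zero_iff, norm_thinEmbed_zero]⟩
    change infDist x' {y' | pev f y' = 0} ≤ ε
    by_contra! h
    have h4 := hδf x' h3 h.le
    nlinarith [sq_nonneg ‖x'‖]

end
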